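/- Let G be a finite group whose order n is not of the form 2^a·3^b·5^c (i.e., n has a prime divisor p ≥ 7). If there exists a positive integer k ≥ 13 such that ψ_k(G) > ((1 + 15·2^k + 20·3^k + 24·5^k) / ((1 + 2^k + 2·4^k)(1 + 2·3^k)(1 + 4·5^k))) · ψ_k(ℤ_n), then G is solvable. -/

import Mathlib

/-- `psi G k` is the sum of the `k`-th powers of the orders of the elements of `G`. -/
noncomputable def psi (G : Type*) [Group G] [Fintype G] (k : ℕ) : ℕ :=
  ∑ g : G, orderOf g ^ k

/-- A group all of whose solvable normal subgroups are trivial. -/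
def TrivialSolvableRadical (G : Type*) [Group G] : Prop :=
  ∀ N : Subgroup G, N.Normal → Group.IsSolvable N → N = ⊥

theorem isSolvable_of_normal_of_quotient {G : Type*} [Group G] {N : Subgroup G} (hN : N.Normal)
    (h₁ : Group.IsSolvable N) (h₂ : Group.IsSolvable (G ⧸ N)) : Group.IsSolvable G :=
  (Group.isSolvable_iff_subgroup_quotient N).2 ⟨h₁, h₂⟩

theorem isSolvable_quotient_normalCore {G : Type*} [Group G] [Finite G] (H : Subgroup G)
    [hS : Group.IsSolvable (Equiv.Perm (Fin H.index))] :
    Group.IsSolvable (G ⧸ H.normalCore) := by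
  have e : G ⧸ H ≃ Fin H.index := Finite.equivFin (G ⧸ H)
  have : Group.IsSolvable (Equiv.Perm (G ⧸ H)) :=
    Group.isSolvable_of_isSolvable_injective (f := (e.permCongrHom : _ →* Equiv.Perm (Fin H.index)))
      e.permCongrHom.injective
  have : Group.IsSolvable (G ⧸ (MulAction.toPermHom G (G ⧸ H)).ker) :=
    Group.isSolvable_of_isSolvable_injective (QuotientGroup.kerLift_injective _)
  exact Group.isSolvable_of_surjective
    (f := (QuotientGroup.quotientMulEquivOfEq H.normalCore_eq_ker).symm.toMonoidHom)
    (MulEquiv.surjective _)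

theorem isSolvable_of_isSolvable_index {G : Type*} [Group G] [Finite G] (H : Subgroup G)
    [hH : Group.IsSolvable H] [hS : Group.IsSolvable (Equiv.Perm (Fin H.index))] :
    Group.IsSolvable G :=
  isSolvable_of_normal_of_quotient H.normalCore_normal
    (Group.isSolvable_of_isSolvable_injective
      (Subgroup.inclusion_injective H.normalCore_le)) (isSolvable_quotient_normalCore H)

theorem isSolvable_of_card_eq_prime_pow {G : Type*} [Group G] [Finite G] {p e : ℕ}
    (hp : p.Prime) (h : Nat.card G = p ^ e) : Group.IsSolvable G := by
  have := Fact.mk hp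
  have := (IsPGroup.of_card h).isNilpotent
  infer_instance

theorem isSolvable_of_card_squarefree {G : Type*} [Group G] [Finite G]
    (h : Squarefree (Nat.card G)) : Group.IsSolvable G := by
  have := IsZGroup.of_squarefree h
  infer_instance

theorem isSolvable_of_card_eq_prime_pow_mul_of_perm {G : Type*} [Group G] [Finite G] {p e i : ℕ}
    (hp : p.Prime) (h : Nat.card G = p ^ e * i)
    (hS : Group.IsSolvable (Equiv.Perm (Fin i))) : Group.IsSolvable G := by
  have := Fact.mk hp
  obtain ⟨H, hH⟩ := Sylow.exists_subgroup_card_pow_prime p (G := G) (n := e) ⟨i, h⟩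
  have := isSolvable_of_card_eq_prime_pow hp hH
  have hi : H.index = i := by
    have := H.card_mul_index
    rw [hH, h] at this
    exact Nat.eq_of_mul_eq_mul_left (pow_pos hp.pos e) this
  subst hi
  exact isSolvable_of_isSolvable_index H

theorem isSolvable_perm_fin_of_le_four {i : ℕ} (hi : i ≤ 4) :
    Group.IsSolvable (Equiv.Perm (Fin i)) := by
  have h₃ : ∀ j ≤ 3, Group.IsSolvable (Equiv.Perm (Fin j)) := by
    intro j hj
    apply isSolvable_of_card_squarefree
    rw [Nat.card_eq_fintype_card, Fintype.card_perm, Fintype.card_fin]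
    interval_cases j <;> simp [Nat.factorial, Nat.squarefree_iff_nodup_primeFactorsList]
  rcases Nat.lt_or_ge 3 i with h | h
  · obtain rfl : i = 4 := by omega
    refine isSolvable_of_card_eq_prime_pow_mul_of_perm (e := 3) (i := 3) Nat.prime_two ?_
      (h₃ 3 le_rfl)
    rw [Nat.card_eq_fintype_card, Fintype.card_perm, Fintype.card_fin]
    rfl
  · exact h₃ i h

theorem isSolvable_of_card_eq_prime_pow_mul {G : Type*} [Group G] [Finite G] {p : ℕ} (e i : ℕ)
    (hp : p.Prime) (hi : i ≤ 4) (h : Nat.card G = p ^ e * i) : Group.IsSolvable G :=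
  isSolvable_of_card_eq_prime_pow_mul_of_perm hp h (isSolvable_perm_fin_of_le_four hi)

theorem isSolvable_of_card_le_thirteen {G : Type*} [Group G] [Finite G]
    (h : Nat.card G ≤ 13) : Group.IsSolvable G := by
  have h0 : 0 < Nat.card G := Nat.card_pos
  obtain ⟨p, e, i, hp, hi, hm⟩ : ∃ p e i : ℕ, p.Prime ∧ i ≤ 4 ∧ Nat.card G = p ^ e * i := by
    generalize Nat.card G = m at h h0
    interval_cases m
    exacts [⟨2, 0, 1, by norm_num⟩, ⟨2, 0, 2, by norm_num⟩, ⟨2, 0, 3, by norm_num⟩,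
      ⟨2, 0, 4, by norm_num⟩, ⟨5, 1, 1, by norm_num⟩, ⟨3, 1, 2, by norm_num⟩,
      ⟨7, 1, 1, by norm_num⟩, ⟨2, 3, 1, by norm_num⟩, ⟨3, 2, 1, by norm_num⟩,
      ⟨5, 1, 2, by norm_num⟩, ⟨11, 1, 1, by norm_num⟩, ⟨2, 2, 3, by norm_num⟩,
      ⟨13, 1, 1, by norm_num⟩]
  exact isSolvable_of_card_eq_prime_pow_mul e i hp hi hm

theorem isSolvable_of_card_dvd_sixty {G : Type*} [Group G] [Finite G]
    (h : Nat.card G ∣ 60) (h' : Nat.card G ≠ 60) : Group.IsSolvable G := by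
  by_cases h₁ : Nat.card G ≤ 13
  · exact isSolvable_of_card_le_thirteen h₁
  have h₂ : Nat.card G = 15 ∨ Nat.card G = 20 ∨ Nat.card G = 30 := by
    obtain ⟨d, hd⟩ := h
    generalize Nat.card G = m at *
    have : d ≤ 4 := by by_contra! hc; nlinarith
    interval_cases d <;> omega
  rcases h₂ with h₂ | h₂ | h₂
  · exact isSolvable_of_card_eq_prime_pow_mul 1 3 Nat.prime_five (by simp) h₂
  · exact isSolvable_of_card_eq_prime_pow_mul 1 4 Nat.prime_five (by simp) h₂
  · apply isSolvable_of_card_squarefree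
    simp [h₂, Nat.squarefree_iff_nodup_primeFactorsList]

namespace TrivialSolvableRadical

variable {G : Type*} [Group G]

theorem not_isSolvable [Nontrivial G] (hG : TrivialSolvableRadical G) :
    ¬ Group.IsSolvable G := fun _ =>
  top_ne_bot (hG ⊤ inferInstance (inferInstance))

theorem toPermHom_injective [Finite G] [Nontrivial G] (hG : TrivialSolvableRadical G)
    (H : Subgroup G) (hH : Group.IsSolvable H) :
    Function.Injective (MulAction.toPermHom G (G ⧸ H)) := by
  rw [← MonoidHom.ker_eq_bot_iff, ← Subgroup.normalCore_eq_ker]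
  exact hG _ H.normalCore_normal (Group.isSolvable_of_isSolvable_injective
      (Subgroup.inclusion_injective H.normalCore_le))

open scoped commutatorElement in
theorem five_le_index_normalizer [Finite G] (hG : TrivialSolvableRadical G) (B : Subgroup G)
    [hB : IsCyclic B] (hB' : B ≠ ⊥) : 5 ≤ (Subgroup.normalizer (B : Set G)).index := by
  by_contra! h
  have := isSolvable_perm_fin_of_le_four (i := (Subgroup.normalizer (B : Set G)).index) (by omega)
  set M := (Subgroup.normalizer (B : Set G)).normalCore with hM
  have hGM : Group.IsSolvable (G ⧸ M) := isSolvable_quotient_normalCore _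
  set T := ⁅M, M⁆ with hT
  have hTM : T ≤ M := Subgroup.commutator_le_self M
  have hGT : Group.IsSolvable (G ⧸ T) := by
    let g : G ⧸ T →* G ⧸ M := QuotientGroup.map T M (MonoidHom.id G) hTM
    refine Group.isSolvable_of_ker_le_range g.ker.subtype g (by simp) (hG' := ?_)
    apply Group.isSolvable_of_comm
    rintro ⟨a, ha⟩ ⟨b, hb⟩
    obtain ⟨a, rfl⟩ := QuotientGroup.mk_surjective a
    obtain ⟨b, rfl⟩ := QuotientGroup.mk_surjective b
    have ha' : a ∈ M := (QuotientGroup.eq_one_iff a).1 ha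
    have hb' : b ∈ M := (QuotientGroup.eq_one_iff b).1 hb
    rw [Subtype.ext_iff]
    change ((a * b : G) : G ⧸ T) = ((b * a : G) : G ⧸ T)
    rw [QuotientGroup.eq]
    have := Subgroup.commutator_mem_commutator (inv_mem hb') (inv_mem ha')
    simpa [commutatorElement_def, mul_assoc] using this
  have hBC : B ≤ Subgroup.centralizer (T : Set G) := by
    rw [Subgroup.le_centralizer_iff, hT, Subgroup.commutator_le]
    intro a ha b hb
    have hMN : M ≤ Subgroup.normalizer (B : Set G) := Subgroup.normalCore_le _
    let a' : Subgroup.normalizer (B : Set G) := ⟨a, hMN ha⟩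
    let b' : Subgroup.normalizer (B : Set G) := ⟨b, hMN hb⟩
    have key : B.normalizerMonoidHom ⁅a', b'⁆ = 1 := by
      rw [map_commutatorElement, commutatorElement_eq_one_iff_mul_comm]
      apply (IsCyclic.mulAutMulEquiv B).injective
      rw [map_mul, map_mul, mul_comm]
    rw [← MonoidHom.mem_ker, Subgroup.normalizerMonoidHom_ker] at key
    exact key
  refine hB' (le_bot_iff.1 (hBC.trans (hG _ inferInstance ?_).le))
  set C := Subgroup.centralizer (T : Set G)
  let f : C →* G ⧸ T := (QuotientGroup.mk' T).comp C.subtype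
  refine Group.isSolvable_of_ker_le_range (f.ker.subtype) f (by simp) (hG' := ?_)
  apply Group.isSolvable_of_comm
  rintro ⟨⟨a, ha⟩, ha'⟩ ⟨⟨b, hb⟩, hb'⟩
  ext
  simp [f, MonoidHom.mem_ker] at ha' hb' ⊢
  exact (Subgroup.mem_centralizer_iff.1 hb a ha')

end TrivialSolvableRadical

theorem mem_zpowers_of_orderOf_eq {G : Type*} [Group G] [Finite G] {A : Subgroup G} [IsCyclic A]
    {y z : G} (hy : y ∈ A) (hz : z ∈ A) (h : orderOf z = orderOf y) :
    z ∈ Subgroup.zpowers y := by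
  classical
  have := Fintype.ofFinite G
  let y' : A := ⟨y, hy⟩
  let z' : A := ⟨z, hz⟩
  have h₁ : orderOf y' = orderOf y := Subgroup.orderOf_mk y hy
  have h₂ : orderOf z' = orderOf z := Subgroup.orderOf_mk z hz
  have hle := IsCyclic.card_pow_eq_one_le (α := A) (orderOf_pos y')
  have hsub : (Finset.univ.filter fun b : A => b ∈ Subgroup.zpowers y') ⊆
      Finset.univ.filter fun b : A => b ^ orderOf y' = 1 := by
    intro b hb
    simp only [Finset.mem_filter, Finset.mem_univ, true_and] at hb ⊢
    obtain ⟨j, rfl⟩ := hb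
    exact orderOf_dvd_iff_pow_eq_one.1 (orderOf_dvd_of_mem_zpowers ⟨j, rfl⟩)
  have hcard : (Finset.univ.filter fun b : A => b ∈ Subgroup.zpowers y').card = orderOf y' := by
    rw [← Nat.card_zpowers, Nat.card_eq_fintype_card, Fintype.card_subtype]
  have heq := Finset.eq_of_subset_of_card_le hsub (hle.trans hcard.ge)
  have hz' : z' ∈ Finset.univ.filter fun b : A => b ^ orderOf y' = 1 := by
    simp only [Finset.mem_filter, Finset.mem_univ, true_and]
    rw [h₁, ← h, ← h₂, pow_orderOf_eq_one]
  rw [← heq] at hz'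
  obtain ⟨j, hj⟩ := (Finset.mem_filter.1 hz').2
  exact ⟨j, congrArg Subtype.val hj⟩

namespace TrivialSolvableRadical

variable {G : Type*} [Group G]

theorem mem_normalizer_of_conj_mem [Finite G] (hG : TrivialSolvableRadical G) {A : Subgroup G}
    [IsCyclic A] (hA : A.index ≤ 13) {x g : G} (hx : x ∈ A) (hx₁ : x ≠ 1)
    (h : g * x * g⁻¹ ∈ A) : g ∈ Subgroup.normalizer (A : Set G) := by
  obtain ⟨q, hq, e, he⟩ : ∃ q, q.Prime ∧ q ∣ orderOf x :=
    Nat.exists_prime_and_dvd (by simpa using hx₁)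
  have he₀ : e ≠ 0 := by
    rintro rfl
    exact (orderOf_pos x).ne' (by simpa using he)
  set y := x ^ e with hy
  have hyo : orderOf y = q := by
    rw [hy, orderOf_pow_of_dvd he₀ ⟨q, by rw [he, mul_comm]⟩, he,
      Nat.mul_div_cancel _ (Nat.pos_of_ne_zero he₀)]
  have hyA : y ∈ A := pow_mem hx e
  have hgy : g * y * g⁻¹ ∈ A := by
    rw [hy, ← conj_pow]
    exact pow_mem h e
  set B := Subgroup.zpowers y with hB
  have hBA : B ≤ A := by simpa [hB] using hyA
  have hgB : g ∈ Subgroup.normalizer (B : Set G) := by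
    have key : g * y * g⁻¹ ∈ B :=
      mem_zpowers_of_orderOf_eq hyA hgy (by
        simpa using orderOf_injective (MulAut.conj g).toMonoidHom (MulAut.conj g).injective y)
    refine Subgroup.mem_normalizer_fintype ?_
    rintro _ ⟨j, rfl⟩
    simp only
    rw [← conj_zpow]
    exact zpow_mem key j
  have hAB : A ≤ Subgroup.normalizer (B : Set G) := by
    rw [Subgroup.le_normalizer_iff]
    rintro a ha _ ⟨j, rfl⟩
    have : a * y ^ j * a⁻¹ = y ^ j := by
      have := congrArg Subtype.val
        ((IsCyclic.commGroup (α := A)).mul_comm ⟨a, ha⟩ ⟨y ^ j, zpow_mem hyA j⟩)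
      change a * y ^ j = y ^ j * a at this
      rw [this, mul_inv_cancel_right]
    simp only [this]
    exact ⟨j, rfl⟩
  have hB₅ : 5 ≤ (Subgroup.normalizer (B : Set G)).index := by
    refine hG.five_le_index_normalizer B ?_
    rw [hB, Ne, Subgroup.zpowers_eq_bot, ← orderOf_eq_one_iff, hyo]
    exact hq.one_lt.ne'
  have hrel := Subgroup.relIndex_mul_index hAB
  have hr₀ : A.relIndex (Subgroup.normalizer (B : Set G)) ≠ 0 := by
    intro h0
    rw [h0, zero_mul] at hrel
    exact Subgroup.index_ne_zero_of_finite hrel.symm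
  have hr₂ : A.relIndex (Subgroup.normalizer (B : Set G)) ≤ 2 := by
    by_contra! hc
    nlinarith
  have hnormal : (A.subgroupOf (Subgroup.normalizer (B : Set G))).Normal := by
    rcases (by omega : A.relIndex (Subgroup.normalizer (B : Set G)) = 1 ∨
      A.relIndex (Subgroup.normalizer (B : Set G)) = 2) with h1 | h1
    · rw [Subgroup.subgroupOf_eq_top.2 (Subgroup.relIndex_eq_one.1 h1)]
      infer_instance
    · exact Subgroup.normal_of_index_eq_two h1
  exact (Subgroup.normal_subgroupOf_iff_le_normalizer hAB).1 hnormal hgB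

theorem card_dvd_index_sub [Finite G] (hG : TrivialSolvableRadical G) {A : Subgroup G}
    [IsCyclic A] (hA : A.index ≤ 13) :
    Nat.card A ∣ A.index - A.relIndex (Subgroup.normalizer (A : Set G)) := by
  classical
  have := Fintype.ofFinite G
  set t := A.relIndex (Subgroup.normalizer (A : Set G)) with ht
  have hfix : Fintype.card (MulAction.fixedPoints A (G ⧸ A)) = t := by
    rw [← Nat.card_eq_fintype_card, Nat.card_congr (Sylow.fixedPointsMulLeftCosetsEquivQuotient A)]
    rfl
  have hfixed : ∀ x : A, x ≠ 1 → Fintype.card (MulAction.fixedBy (G ⧸ A) x) = t := by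
    intro x hx
    rw [← hfix]
    refine Fintype.card_congr (Equiv.setCongr ?_)
    ext q
    obtain ⟨g, rfl⟩ := QuotientGroup.mk_surjective q
    rw [Sylow.mem_fixedPoints_mul_left_cosets_iff_mem_normalizer]
    have hstep : (g : G ⧸ A) ∈ MulAction.fixedBy (G ⧸ A) x ↔ g⁻¹ * x * g ∈ A := by
      rw [MulAction.mem_fixedBy]
      change ((x * g : G) : G ⧸ A) = _ ↔ _
      rw [eq_comm, QuotientGroup.eq, mul_assoc]
    rw [hstep]
    constructor
    · intro h
      rw [← inv_mem_iff]
      exact hG.mem_normalizer_of_conj_mem hA x.2 (by simpa using hx) (by simpa using h)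
    · intro h
      have := (Subgroup.mem_normalizer_iff.1 (inv_mem h) (x : G)).1 x.2
      simpa using this
  have hsum := MulAction.sum_card_fixedBy_eq_card_orbits_mul_card_group A (G ⧸ A)
  rw [← Finset.add_sum_erase _ _ (Finset.mem_univ (1 : A)),
    Finset.sum_congr rfl (fun x hx => hfixed x (Finset.ne_of_mem_erase hx)), Finset.sum_const,
    Finset.card_erase_of_mem (Finset.mem_univ _), Finset.card_univ] at hsum
  have h1 : Fintype.card (MulAction.fixedBy (G ⧸ A) (1 : A)) = A.index := by
    rw [Subgroup.index, Nat.card_eq_fintype_card]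
    exact Fintype.card_congr ((Equiv.setCongr (by ext; simp)).trans (Equiv.Set.univ _))
  rw [h1] at hsum
  have htle : t ≤ A.index := Nat.le_of_dvd (Nat.pos_of_ne_zero Subgroup.index_ne_zero_of_finite)
    (Subgroup.relIndex_dvd_index_of_le Subgroup.le_normalizer)
  have hc : 0 < Fintype.card A := Fintype.card_pos
  rw [Nat.card_eq_fintype_card]
  generalize Fintype.card A = a at *
  obtain ⟨b, rfl⟩ : ∃ b, a = b + 1 := ⟨a - 1, by omega⟩
  rw [← Nat.dvd_add_left (dvd_mul_right (b + 1) t)]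
  refine ⟨_, Eq.trans ?_ (hsum.trans (mul_comm _ _))⟩
  simp only [smul_eq_mul, Nat.add_sub_cancel]
  have : A.index - t + t = A.index := Nat.sub_add_cancel htle
  nlinarith

end TrivialSolvableRadical

namespace TrivialSolvableRadical

variable {G : Type*} [Group G]

theorem exists_dvd_modEq_one [Finite G] [Nontrivial G] (hG : TrivialSolvableRadical G) {p r : ℕ}
    (e : ℕ) (hp : p.Prime) (he : e ≠ 0) (h : Nat.card G = p ^ e * r) (hr : ¬ p ∣ r) :
    ∃ d, d ∣ r ∧ d ≡ 1 [MOD p] ∧ d ≠ 1 := by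
  have := Fact.mk hp
  obtain ⟨P⟩ := (inferInstance : Nonempty (Sylow p G))
  have hcard : Nat.card P = p ^ e := by
    rw [P.card_eq_multiplicity, h, Nat.factorization_mul (pow_ne_zero _ hp.ne_zero)
      (by rintro rfl; simp at hr)]
    simp [hp.factorization, Nat.factorization_eq_zero_of_not_dvd hr]
  have hi : (P : Subgroup G).index = r := by
    have := (P : Subgroup G).card_mul_index
    rw [hcard, h] at this
    exact Nat.eq_of_mul_eq_mul_left (pow_pos hp.pos e) this
  refine ⟨Nat.card (Sylow p G), hi ▸ P.card_dvd_index, card_sylow_modEq_one p G, fun h1 => ?_⟩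
  rw [P.card_eq_index_normalizer, Subgroup.index_eq_one] at h1
  have hb := hG _ (Subgroup.normalizer_eq_top_iff.1 h1) (isSolvable_of_card_eq_prime_pow hp hcard)
  rw [← Subgroup.card_eq_one] at hb
  exact (Nat.one_lt_pow he hp.one_lt).ne' (hcard.symm.trans hb)

theorem not_normalizer_le_centralizer [Finite G] [Nontrivial G] (hG : TrivialSolvableRadical G)
    {p : ℕ} [Fact p.Prime] (P : Sylow p G)
    (h : ∀ N : Subgroup G, Nat.card N = (P : Subgroup G).index → Group.IsSolvable N) :
    ¬ Subgroup.normalizer (P : Set G) ≤ Subgroup.centralizer (P : Set G) := by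
  intro hP
  have hc := MonoidHom.ker_transferSylow_isComplement' P hP
  have hb := hG _ inferInstance (h _ hc.index_eq_card.symm)
  rw [hb, Subgroup.isComplement'_bot_left] at hc
  have hc' : Nat.card G = p ^ (Nat.card G).factorization p := by
    rw [← P.card_eq_multiplicity]
    exact ((Nat.card_congr (Equiv.setCongr (congrArg SetLike.coe hc))).trans
      Nat.card_univ).symm
  exact hG.not_isSolvable (isSolvable_of_card_eq_prime_pow Fact.out hc')

theorem normalizer_ne_self [Finite G] [Nontrivial G] (hG : TrivialSolvableRadical G)
    {A : Subgroup G} [IsCyclic A] (hA : A.index ≤ 13) {p : ℕ} (e : ℕ) (hp : p.Prime)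
    (h : Nat.card A = p ^ e) (hi : ¬ p ∣ A.index) : Subgroup.normalizer (A : Set G) ≠ A := by
  intro hN
  have := Fact.mk hp
  let P : Sylow p G := (IsPGroup.of_card h).toSylow hi
  have hP : (P : Subgroup G) = A := rfl
  refine hG.not_normalizer_le_centralizer P (fun N hN => ?_) ?_
  · exact isSolvable_of_card_le_thirteen (hN.le.trans (hP ▸ hA))
  · change Subgroup.normalizer (A : Set G) ≤ Subgroup.centralizer (A : Set G)
    rw [hN]
    exact Subgroup.le_centralizer_iff_isMulCommutative.2 inferInstance

theorem card_dvd_factorial_index [Finite G] [Nontrivial G] (hG : TrivialSolvableRadical G)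
    (H : Subgroup G) (hH : Group.IsSolvable H) : Nat.card G ∣ H.index.factorial := by
  have := Subgroup.card_dvd_of_injective _ (hG.toPermHom_injective H hH)
  rwa [Nat.card_perm] at this

end TrivialSolvableRadical

theorem orderOf_perm_fin_six_ne_ten (σ : Equiv.Perm (Fin 6)) : orderOf σ ≠ 10 := by
  intro h
  have hsum : σ.cycleType.sum ≤ 6 := by
    rw [Equiv.Perm.sum_cycleType]
    exact σ.support.card_le_univ
  have hlcm := σ.lcm_cycleType
  have h5 : 5 ∈ σ.cycleType := by
    by_contra h5
    have : σ.cycleType.lcm ∣ 12 := by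
      refine Multiset.lcm_dvd.2 fun c hc => ?_
      have h1 := Equiv.Perm.two_le_of_mem_cycleType hc
      have h2 := (Multiset.le_sum_of_mem hc).trans hsum
      have h3 : c ≠ 5 := by rintro rfl; exact h5 hc
      interval_cases c <;> simp_all
    rw [hlcm, h] at this
    norm_num at this
  obtain ⟨s, hs⟩ := Multiset.exists_cons_of_mem h5
  have hs0 : s = 0 := by
    refine Multiset.eq_zero_of_forall_notMem fun c hc => ?_
    have h1 : 2 ≤ c := Equiv.Perm.two_le_of_mem_cycleType
      (σ := σ) (by rw [hs]; exact Multiset.mem_cons_of_mem hc)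
    have h2 := Multiset.le_sum_of_mem hc
    rw [hs, Multiset.sum_cons] at hsum
    omega
  rw [hs, hs0, h] at hlcm
  simp at hlcm

namespace TrivialSolvableRadical

variable {G : Type*} [Group G]

theorem card_eq_of_index_le_thirteen [Finite G] [Nontrivial G] (hG : TrivialSolvableRadical G)
    {A : Subgroup G} [hAc : IsCyclic A] (hA : A.index ≤ 13) :
    Nat.card G = 60 ∧ Nat.card A = 5 := by
  have hdvd := hG.card_dvd_index_sub hA
  set t := A.relIndex (Subgroup.normalizer (A : Set G)) with ht
  have hmul : t * (Subgroup.normalizer (A : Set G)).index = A.index :=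
    Subgroup.relIndex_mul_index Subgroup.le_normalizer
  have hcard := A.card_mul_index
  have hA1 : A ≠ ⊥ := by
    rintro rfl
    simp only [Subgroup.index_bot] at hA
    exact hG.not_isSolvable (isSolvable_of_card_le_thirteen hA)
  have ha1 : Nat.card A ≠ 1 := by rwa [Ne, Subgroup.card_eq_one]
  have hN5 := hG.five_le_index_normalizer A hA1
  have hNs : t * Nat.card A = Nat.card (Subgroup.normalizer (A : Set G)) := by
    have h1 := (Subgroup.normalizer (A : Set G)).card_mul_index
    rw [← hcard, ← hmul, ← mul_assoc] at h1
    rw [mul_comm]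
    exact (Nat.eq_of_mul_eq_mul_right (by omega) h1).symm
  have ht0 : t ≠ 0 := by
    rintro h0
    rw [h0, zero_mul] at hmul
    exact Subgroup.index_ne_zero_of_finite hmul.symm
  have ht2 : t ≤ 2 := by
    by_contra! hc
    nlinarith
  have hself : t = 1 → Subgroup.normalizer (A : Set G) = A := fun h =>
    le_antisymm (Subgroup.relIndex_eq_one.1 h) Subgroup.le_normalizer
  have hself' : t = 1 → ∀ p e, p.Prime → ¬ p ∣ A.index → Nat.card A ≠ p ^ e :=
    fun h p e hp hi hc => hG.normalizer_ne_self hA e hp hc hi (hself h)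
  have hsyl : ∀ e p r : ℕ, p.Prime → e ≠ 0 → Nat.card G = p ^ e * r → ¬ p ∣ r →
    ∃ d, d ≤ r ∧ d ∣ r ∧ d ≡ 1 [MOD p] ∧ d ≠ 1 := fun e p r hp he h hr => by
    obtain ⟨d, h1, h2⟩ := hG.exists_dvd_modEq_one e hp he h hr
    exact ⟨d, Nat.le_of_dvd (Nat.pos_of_ne_zero (by rintro rfl; simp at hr)) h1, h1, h2⟩
  have hsol : ∀ p e i : ℕ, p.Prime → i ≤ 4 → Nat.card G ≠ p ^ e * i := fun p e i hp hi h =>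
    hG.not_isSolvable (isSolvable_of_card_eq_prime_pow_mul e i hp hi h)
  rcases (by omega : t = 1 ∨ t = 2) with h1 | h1
  · exfalso
    have hself' := hself' h1
    rw [h1] at hdvd
    clear hself ht
    generalize Nat.card A = a at *
    generalize A.index = m at *
    rw [← hcard] at hsyl hsol
    have hm : 5 ≤ m := by
      rw [h1, one_mul] at hmul
      exact hmul ▸ hN5
    have ha : a ≤ m - 1 := Nat.le_of_dvd (by omega) hdvd
    have ha0 : a ≠ 0 := by
      rintro rfl
      rw [zero_dvd_iff] at hdvd
      omega
    have hmp : ¬ m.Prime := by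
      intro hp
      obtain ⟨d, hd, -, hd1, hd2⟩ := hsyl 1 m a hp one_ne_zero (by ring)
        (fun h => absurd (Nat.le_of_dvd (by omega) h) (by omega))
      have := hd1.eq_of_lt_of_lt (by omega) (by omega)
      exact hd2 this
    clear hsyl hsol hcard
    interval_cases m <;> first | (exfalso; revert hmp; norm_num; done) | skip
    · exact hself' 5 1 (by norm_num) (by norm_num) (by interval_cases a <;> omega)
    · exact hself' 7 1 (by norm_num) (by norm_num) (by interval_cases a <;> omega)
    · obtain ⟨e, -, he⟩ := (Nat.dvd_prime_pow Nat.prime_two (m := 3)).1 hdvd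
      exact hself' 2 e (by norm_num) (by norm_num) he
    · obtain ⟨e, -, he⟩ := (Nat.dvd_prime_pow Nat.prime_three (m := 2)).1 hdvd
      exact hself' 3 e (by norm_num) (by norm_num) he
    · exact hself' 11 1 (by norm_num) (by norm_num) (by interval_cases a <;> omega)
  · have hfac := hG.card_dvd_factorial_index (Subgroup.normalizer (A : Set G))
    have hinj := hG.toPermHom_injective (Subgroup.normalizer (A : Set G))
    rw [h1] at hdvd hNs hmul
    obtain ⟨x, hx⟩ := hAc.exists_ofOrder_eq_natCard
    have hNsol : ∀ p e i : ℕ, p.Prime → i ≤ 4 → 2 * Nat.card A = p ^ e * i →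
        Group.IsSolvable (Subgroup.normalizer (A : Set G)) := fun p e i hp hi h =>
      isSolvable_of_card_eq_prime_pow_mul e i hp hi (hNs ▸ h)
    have hm : A.index = 10 ∨ A.index = 12 := by omega
    rcases hm with hm | hm
    · exfalso
      rw [hm] at hcard hdvd hmul
      have hN : (Subgroup.normalizer (A : Set G)).index = 5 := by omega
      rw [hN] at hfac
      obtain ⟨e, he, he'⟩ := (Nat.dvd_prime_pow Nat.prime_two (m := 3)).1 hdvd
      rw [he'] at hNsol hcard
      specialize hfac (hNsol 2 (e + 1) 1 Nat.prime_two (by norm_num) (by ring))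
      interval_cases e
      · exact ha1 he'
      · exact hsol 5 1 4 Nat.prime_five le_rfl hcard.symm
      · obtain ⟨d, hd, hd', hd1, hd2⟩ := hsyl 1 5 8 Nat.prime_five one_ne_zero hcard.symm
          (by norm_num)
        clear * - hd hd' hd1 hd2
        rw [Nat.ModEq] at hd1
        interval_cases d <;> simp_all
      · rw [← hcard] at hfac
        revert hfac
        norm_num [Nat.factorial]
    · rw [hm] at hcard hdvd hmul
      have hN : (Subgroup.normalizer (A : Set G)).index = 6 := by omega
      have ha10 := Nat.le_of_dvd (by norm_num) hdvd
      have ha : Nat.card A = 2 ∨ Nat.card A = 5 ∨ Nat.card A = 10 := by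
        generalize Nat.card A = a at *
        clear * - ha10 hdvd ha1
        interval_cases a <;> simp_all
      rcases ha with ha | ha | ha
      · exact (hsol 2 3 3 Nat.prime_two (by norm_num) (by rw [← hcard, ha]; rfl)).elim
      · exact ⟨by rw [← hcard, ha], ha⟩
      · exfalso
        specialize hinj (hNsol 5 1 4 Nat.prime_five le_rfl (by rw [ha]; rfl))
        let e : G ⧸ Subgroup.normalizer (A : Set G) ≃ Fin 6 :=
          (Finite.equivFin (G ⧸ Subgroup.normalizer (A : Set G))).trans (finCongr hN)
        refine orderOf_perm_fin_six_ne_ten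
          (e.permCongrHom (MulAction.toPermHom G _ (x : G))) ?_
        rw [← ha, ← hx, ← Subgroup.orderOf_coe, MulEquiv.orderOf_eq]
        exact orderOf_injective _ hinj _

end TrivialSolvableRadical

namespace TrivialSolvableRadical

variable {G : Type*} [Group G]

open scoped commutatorElement in
theorem commutator_eq_top [Finite G] [Nontrivial G] (hG : TrivialSolvableRadical G)
    (h60 : Nat.card G = 60) : commutator G = ⊤ := by
  by_contra hne
  have hd := (commutator G).card_subgroup_dvd_card
  rw [h60] at hd
  have hsol := isSolvable_of_card_dvd_sixty hd (fun h => hne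
    ((commutator G).eq_top_of_card_eq (h.trans h60.symm)))
  have hb := hG _ inferInstance hsol
  refine hG.not_isSolvable (Group.isSolvable_of_comm fun a b => ?_)
  have : ⁅a, b⁆ ∈ commutator G := Subgroup.commutator_mem_commutator
    (Subgroup.mem_top a) (Subgroup.mem_top b)
  rw [hb, Subgroup.mem_bot, commutatorElement_eq_one_iff_mul_comm] at this
  exact this

theorem card_sylow [Finite G] [Nontrivial G] (hG : TrivialSolvableRadical G)
    (h60 : Nat.card G = 60) {r : ℕ} (hr : r = 3 ∨ r = 5) [Fact r.Prime] (P : Sylow r G)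
    (hP : Nat.card P = r) : Nat.card (Sylow r G) = 60 / (2 * r) := by
  have hi : (P : Subgroup G).index = 60 / r := by
    have := (P : Subgroup G).card_mul_index
    rw [hP, h60] at this
    rw [← this, Nat.mul_div_cancel_left _ (Fact.out : r.Prime).pos]
  have := isCyclic_of_prime_card hP
  have h5 : 5 ≤ Nat.card (Sylow r G) := by
    rw [P.card_eq_index_normalizer]
    refine hG.five_le_index_normalizer P ?_
    rw [Ne, ← Subgroup.card_eq_one, hP]
    exact (Fact.out : r.Prime).one_lt.ne'
  have hd := P.card_dvd_index
  have hm := card_sylow_modEq_one r G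
  rw [hi] at hd
  generalize Nat.card (Sylow r G) = n at *
  clear * - hr hd hm h5
  rw [Nat.ModEq] at hm
  rcases hr with rfl | rfl
  · have := Nat.le_of_dvd (by norm_num) hd
    interval_cases n <;> simp_all
  · have := Nat.le_of_dvd (by norm_num) hd
    interval_cases n <;> simp_all

theorem exists_sylow_eq_zpowers [Finite G] (h60 : Nat.card G = 60) {r : ℕ} (hr : r = 3 ∨ r = 5)
    [Fact r.Prime] {x : G} (hx : orderOf x = r) : ∃ P : Sylow r G, P = Subgroup.zpowers x := by
  have hc : Nat.card (Subgroup.zpowers x) = r ^ 1 := by rw [Nat.card_zpowers, hx, pow_one]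
  refine ⟨(IsPGroup.of_card hc).toSylow ?_, rfl⟩
  have := (Subgroup.zpowers x).card_mul_index
  rw [hc, h60] at this
  generalize (Subgroup.zpowers x).index = i at *
  rcases hr with rfl | rfl
  · omega
  · omega

theorem not_normalizer_zpowers_le_centralizer [Finite G] [Nontrivial G]
    (hG : TrivialSolvableRadical G)
    (h60 : Nat.card G = 60) {r : ℕ} (hr : r = 3 ∨ r = 5) {x : G} (hx : orderOf x = r) :
    ¬ Subgroup.normalizer (Subgroup.zpowers x : Set G) ≤
      Subgroup.centralizer (Subgroup.zpowers x : Set G) := by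
  have : Fact r.Prime := ⟨by rcases hr with rfl | rfl <;> norm_num⟩
  obtain ⟨P, hP⟩ := exists_sylow_eq_zpowers h60 hr hx
  have hi := (P : Subgroup G).card_mul_index
  rw [hP, Nat.card_zpowers, hx, h60] at hi
  have hn := hG.not_normalizer_le_centralizer P fun N hN => by
    rw [hP] at hN
    refine isSolvable_of_card_dvd_sixty (hN ▸ ⟨r, by rw [← hi, mul_comm]⟩) ?_
    rcases hr with rfl | rfl <;> omega
  have hPs : (P : Set G) = Subgroup.zpowers x := congrArg SetLike.coe hP
  rwa [hPs] at hn

theorem exists_conj_mem_zpowers_ne [Finite G] [Nontrivial G] (hG : TrivialSolvableRadical G)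
    (h60 : Nat.card G = 60) {r : ℕ} (hr : r = 3 ∨ r = 5) {x : G} (hx : orderOf x = r) :
    ∃ g : G, g * x * g⁻¹ ∈ Subgroup.zpowers x ∧ g * x * g⁻¹ ≠ x := by
  obtain ⟨g, hg, hg'⟩ := SetLike.not_le_iff_exists.1
    (hG.not_normalizer_zpowers_le_centralizer h60 hr hx)
  refine ⟨g, (Subgroup.mem_normalizer_iff.1 hg x).1 (Subgroup.mem_zpowers x), fun h => hg' ?_⟩
  rw [Subgroup.mem_centralizer_iff]
  rintro _ ⟨j, rfl⟩
  have hc : Commute g x := by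
    rw [commute_iff_eq]
    nth_rw 2 [← h]
    group
  exact (hc.zpow_right j).eq.symm

theorem orderOf_eq_of_dvd [Finite G] [Nontrivial G] (hG : TrivialSolvableRadical G)
    (h60 : Nat.card G = 60) {r : ℕ} (hr : r = 3 ∨ r = 5) {x : G} (hx : r ∣ orderOf x) :
    orderOf x = r := by
  have hrp : Fact r.Prime := ⟨by rcases hr with rfl | rfl <;> norm_num⟩
  obtain ⟨e, he⟩ := hx
  have he0 : e ≠ 0 := by
    rintro rfl
    exact (orderOf_pos x).ne' (by simpa using he)
  have hy : orderOf (x ^ e) = r := by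
    rw [orderOf_pow_of_dvd he0 ⟨r, by rw [he, mul_comm]⟩, he,
      Nat.mul_div_cancel _ (Nat.pos_of_ne_zero he0)]
  obtain ⟨P, hP⟩ := exists_sylow_eq_zpowers h60 hr hy
  have hPc : Nat.card P = r := by rw [hP, Nat.card_zpowers, hy]
  have hN := P.card_eq_index_normalizer.symm.trans (hG.card_sylow h60 hr P hPc)
  have hPs : (P : Set G) = Subgroup.zpowers (x ^ e) := congrArg SetLike.coe hP
  rw [hPs] at hN
  set N := Subgroup.normalizer (Subgroup.zpowers (x ^ e) : Set G)
  set C := Subgroup.centralizer (Subgroup.zpowers (x ^ e) : Set G)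
  have hNc := N.card_mul_index
  rw [hN, h60] at hNc
  have hCN : C ≤ N := Subgroup.centralizer_le_normalizer _
  have hCne : C ≠ N := fun h =>
    hG.not_normalizer_zpowers_le_centralizer h60 hr hy h.ge
  have hxC : x ∈ C := by
    rw [Subgroup.mem_centralizer_iff]
    rintro _ ⟨j, rfl⟩
    exact (((Commute.refl x).pow_left e).zpow_left j).eq
  have hCc := Subgroup.card_dvd_of_le hCN
  have hxc := (orderOf_dvd_natCard (⟨x, hxC⟩ : C))
  rw [Subgroup.orderOf_mk] at hxc
  have hCc' : Nat.card C ≠ Nat.card N := fun h => hCne (Subgroup.eq_of_le_of_card_ge hCN h.ge)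
  have hNr : Nat.card N = 2 * r := by
    rcases hr with rfl | rfl <;> omega
  rw [hNr] at hCc hCc'
  refine Nat.dvd_antisymm (hxc.trans ?_) (Dvd.intro _ he.symm)
  obtain ⟨f, hf⟩ := (Dvd.intro _ he.symm).trans hxc
  rw [hf, mul_comm 2, Nat.mul_dvd_mul_iff_left hrp.out.pos] at hCc
  rw [hf, mul_comm 2] at hCc'
  rcases (Nat.dvd_prime Nat.prime_two).1 hCc with rfl | rfl
  · rw [hf, mul_one]
  · exact absurd rfl hCc'

theorem orderOf_mem [Finite G] [Nontrivial G] (hG : TrivialSolvableRadical G)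
    (h60 : Nat.card G = 60) (x : G) :
    orderOf x = 1 ∨ orderOf x = 2 ∨ orderOf x = 3 ∨ orderOf x = 5 := by
  have h3 := hG.orderOf_eq_of_dvd h60 (Or.inl rfl) (x := x)
  have h5 := hG.orderOf_eq_of_dvd h60 (Or.inr rfl) (x := x)
  by_cases h3' : 3 ∣ orderOf x
  · simp [h3 h3']
  by_cases h5' : 5 ∣ orderOf x
  · simp [h5 h5']
  have h4 : orderOf x ∣ 4 := by
    have := orderOf_dvd_natCard x
    rw [h60] at this
    have hc : Nat.Coprime (orderOf x) 15 :=
      Nat.Coprime.mul_right (n := 5) (m := 3)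
        ((Nat.Prime.coprime_iff_not_dvd Nat.prime_three).2 h3').symm
        ((Nat.Prime.coprime_iff_not_dvd Nat.prime_five).2 h5').symm
    exact hc.dvd_of_dvd_mul_right (m := 4) this
  have hne : orderOf x ≠ 4 := by
    intro h4
    have : Fact (Nat.Prime 2) := ⟨Nat.prime_two⟩
    have hc : Nat.card (Subgroup.zpowers x) = 2 ^ 2 := by rw [Nat.card_zpowers, h4]; rfl
    have hi := (Subgroup.zpowers x).card_mul_index
    rw [hc, h60] at hi
    let P : Sylow 2 G := (IsPGroup.of_card hc).toSylow (by omega)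
    have hP : (P : Subgroup G) = Subgroup.zpowers x := rfl
    have : IsCyclic P := by
      change IsCyclic (Subgroup.zpowers x)
      infer_instance
    refine hG.not_normalizer_le_centralizer P (fun N hN => ?_)
      (IsCyclic.normalizer_le_centralizer (by rw [h60]; norm_num) this)
    rw [hP] at hN
    refine isSolvable_of_card_dvd_sixty ⟨4, ?_⟩ ?_ <;> omega
  have := Nat.le_of_dvd (by norm_num) h4
  have := orderOf_pos x
  generalize orderOf x = d at *
  interval_cases d <;> simp_all

theorem card_orderOf_eq_le [Fintype G] [Nontrivial G] [DecidableEq G]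
    (hG : TrivialSolvableRadical G)
    (h60 : Nat.card G = 60) {r : ℕ} (hr : r = 3 ∨ r = 5) :
    (Finset.univ.filter fun x : G => orderOf x = r).card ≤ (r - 1) * (60 / (2 * r)) := by
  classical
  have hrp : Fact r.Prime := ⟨by rcases hr with rfl | rfl <;> norm_num⟩
  rcases (Finset.univ.filter fun x : G => orderOf x = r).eq_empty_or_nonempty with h0 | ⟨x, hx⟩
  · simp [h0]
  obtain ⟨P, hP⟩ := exists_sylow_eq_zpowers h60 hr (Finset.mem_filter.1 hx).2
  have hPc : Nat.card P = r := by
    rw [hP, Nat.card_zpowers, (Finset.mem_filter.1 hx).2]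
  have hn := hG.card_sylow h60 hr P hPc
  have := Fintype.ofFinite (Sylow r G)
  rw [Nat.card_eq_fintype_card] at hn
  rw [← hn]
  refine (Finset.card_le_mul_card_image_of_maps_to (f := Subgroup.zpowers)
    (t := Finset.univ.image fun P : Sylow r G => (P : Subgroup G)) ?_ (r - 1) ?_).trans
    (Nat.mul_le_mul_left _ Finset.card_image_le)
  · intro y hy
    obtain ⟨Q, hQ⟩ := exists_sylow_eq_zpowers h60 hr (Finset.mem_filter.1 hy).2
    exact Finset.mem_image.2 ⟨Q, Finset.mem_univ _, hQ⟩
  · intro B hB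
    obtain ⟨Q, -, rfl⟩ := Finset.mem_image.1 hB
    have hQc : Fintype.card Q = r := by
      rw [← Nat.card_eq_fintype_card]
      refine Eq.trans ?_ hPc
      exact Nat.card_congr (Q.equiv P).toEquiv
    have hsub : ((Finset.univ.filter fun x : G => orderOf x = r).filter
        fun x => Subgroup.zpowers x = Q) ⊆ (Finset.univ.filter fun x : G => x ∈ Q).erase 1 := by
      intro y hy
      simp only [Finset.mem_filter, Finset.mem_univ, true_and, Finset.mem_erase] at hy ⊢
      refine ⟨?_, ?_⟩
      · rintro rfl
        rw [orderOf_one] at hy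
        exact hrp.out.one_lt.ne hy.1
      · change y ∈ (Q : Subgroup G)
        rw [← hy.2]
        exact Subgroup.mem_zpowers y
    refine (Finset.card_le_card hsub).trans ?_
    rw [Finset.card_erase_of_mem (by simp [one_mem])]
    refine Nat.sub_le_sub_right ((Fintype.card_subtype _).symm.trans ?_).le _
    exact hQc

theorem sum_orderOf_le [Fintype G] [Nontrivial G] (hG : TrivialSolvableRadical G)
    (h60 : Nat.card G = 60) (w : ℕ → ℕ) (h23 : w 2 ≤ w 3) (h35 : w 3 ≤ w 5) :
    ∑ x : G, w (orderOf x) ≤ w 1 + 15 * w 2 + 20 * w 3 + 24 * w 5 := by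
  classical
  have h3 := hG.card_orderOf_eq_le h60 (Or.inl rfl)
  have h5 := hG.card_orderOf_eq_le h60 (Or.inr rfl)
  norm_num at h3 h5
  have hmaps : ∀ x ∈ (Finset.univ : Finset G), orderOf x ∈ ({1, 2, 3, 5} : Finset ℕ) := by
    intro x _
    simpa using hG.orderOf_mem h60 x
  have hsum : ∑ x : G, w (orderOf x) = ∑ d ∈ ({1, 2, 3, 5} : Finset ℕ),
      (Finset.univ.filter fun x : G => orderOf x = d).card * w d := by
    rw [← Finset.sum_fiberwise_of_maps_to hmaps]
    refine Finset.sum_congr rfl fun d _ => ?_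
    rw [Finset.sum_congr rfl fun x hx => by rw [(Finset.mem_filter.1 hx).2], Finset.sum_const,
      smul_eq_mul]
  have hcard := Finset.card_eq_sum_card_fiberwise hmaps
  have h1 : (Finset.univ.filter fun x : G => orderOf x = 1).card = 1 := by
    rw [Finset.card_eq_one]
    exact ⟨1, by ext; simp⟩
  rw [Finset.card_univ, ← Nat.card_eq_fintype_card, h60] at hcard
  rw [hsum]
  rw [Finset.sum_insert (by decide), Finset.sum_insert (by decide),
    Finset.sum_insert (by decide), Finset.sum_singleton, h1] at hcard ⊢
  obtain ⟨a, ha⟩ := Nat.exists_eq_add_of_le h23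
  obtain ⟨b, hb⟩ := Nat.exists_eq_add_of_le h35
  generalize (Finset.univ.filter fun x : G => orderOf x = 2).card = c2 at *
  generalize (Finset.univ.filter fun x : G => orderOf x = 3).card = c3 at *
  generalize (Finset.univ.filter fun x : G => orderOf x = 5).card = c5 at *
  obtain rfl : c2 = 59 - c3 - c5 := by omega
  obtain ⟨c2, hc2⟩ : ∃ c, c + c3 + c5 = 59 := ⟨59 - c3 - c5, by omega⟩
  rw [show 59 - c3 - c5 = c2 by omega, hb, ha]
  have e1 := Nat.mul_le_mul_right a (show c3 + c5 ≤ 44 by omega)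
  have e2 := Nat.mul_le_mul_right b h5
  have e3 := congrArg (· * w 2) hc2
  nlinarith

end TrivialSolvableRadical

section CentralExtension

open scoped commutatorElement

variable {G : Type*} [Group G] {K : Subgroup G}

theorem le_center_of_commutator_quotient_eq_top [K.Normal] [hK : IsCyclic K]
    (h : commutator (G ⧸ K) = ⊤) : K ≤ Subgroup.center G := by
  let φ : G →* MulAut K := MulAut.conjNormal
  have hKφ : K ≤ φ.ker := by
    intro x hx
    rw [MonoidHom.mem_ker]
    ext u
    have := congrArg Subtype.val ((IsCyclic.commGroup (α := K)).mul_comm ⟨x, hx⟩ u)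
    change x * u = u * x at this
    simp [φ, MulAut.conjNormal_apply, this]
  have hCφ : commutator G ≤ φ.ker := by
    rw [commutator_def, Subgroup.commutator_le]
    intro a _ b _
    rw [MonoidHom.mem_ker, map_commutatorElement, commutatorElement_eq_one_iff_mul_comm]
    apply (IsCyclic.mulAutMulEquiv K).injective
    rw [map_mul, map_mul, mul_comm]
  have htop : φ.ker = ⊤ := by
    rw [eq_top_iff]
    intro g _
    have hg : (g : G ⧸ K) ∈ (commutator G).map (QuotientGroup.mk' K) := by
      rw [commutator_def, Subgroup.map_commutator,
        Subgroup.map_top_of_surjective _ (QuotientGroup.mk'_surjective K), ← commutator_def, h]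
      exact Subgroup.mem_top _
    obtain ⟨c, hc, hcg⟩ := hg
    have := hKφ (QuotientGroup.eq.1 hcg)
    have := mul_mem (hCφ hc) this
    rwa [mul_inv_cancel_left] at this
  intro u hu
  rw [Subgroup.mem_center_iff]
  intro g
  have hg : g ∈ φ.ker := htop ▸ Subgroup.mem_top g
  have := congrArg Subtype.val (DFunLike.congr_fun (MonoidHom.mem_ker.1 hg) ⟨u, hu⟩)
  simp only [φ, MulAut.conjNormal_apply, MulAut.one_apply] at this
  exact mul_inv_eq_iff_eq_mul.1 this

theorem sum_orderOf_mul_pow_le [Fintype K] (hK : K ≤ Subgroup.center G) {g : G} {z : K} {r : ℕ}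
    (hr : r ≠ 0) (h : g ^ r = (z : G) ^ r) (k : ℕ) :
    ∑ u : K, orderOf (g * u) ^ k ≤ r ^ k * psi K k := by
  rw [← Equiv.sum_comp (Equiv.mulLeft z⁻¹), psi, Finset.mul_sum]
  refine Finset.sum_le_sum fun u _ => ?_
  rw [← mul_pow]
  refine Nat.pow_le_pow_left (Nat.le_of_dvd (Nat.mul_pos (Nat.pos_of_ne_zero hr) (orderOf_pos u))
    (orderOf_dvd_of_pow_eq_one ?_)) k
  have hc : ∀ (x : K) (y : G), Commute y x := fun x y =>
    (Subgroup.mem_center_iff.1 (hK x.2) y)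
  have hu : (u : G) ^ orderOf u = 1 := by
    rw [← Subgroup.coe_pow, pow_orderOf_eq_one, Subgroup.coe_one]
  simp only [Equiv.coe_mulLeft, Subgroup.coe_mul, Subgroup.coe_inv]
  rw [← Subgroup.coe_inv, (((hc z⁻¹ g).mul_right (hc u g))).mul_pow, (hc u _).mul_pow, mul_comm r,
    pow_mul, pow_mul, pow_mul, hu, one_pow, mul_one]
  rw [← pow_mul g, mul_comm, pow_mul, h, ← pow_mul, mul_comm, pow_mul, Subgroup.coe_inv,
    inv_pow, inv_pow, mul_inv_cancel]

theorem sum_eq_sum_quotient_sum [Fintype G] [Fintype K] [Fintype (G ⧸ K)] (f : G → ℕ) :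
    ∑ g, f g = ∑ q : G ⧸ K, ∑ u : K, f (q.out * u) := by
  rw [← Fintype.sum_prod_type' (f := fun (q : G ⧸ K) (u : K) => f (q.out * u))]
  symm
  refine Fintype.sum_bijective (fun x : (G ⧸ K) × K => x.1.out * (x.2 : G)) ⟨?_, fun g => ?_⟩ _ _
    fun _ => rfl
  · rintro ⟨q, u⟩ ⟨q', u'⟩ h
    have hq := congrArg (QuotientGroup.mk (s := K)) h
    simp only [QuotientGroup.mk_mul_of_mem _ u.2, QuotientGroup.mk_mul_of_mem _ u'.2,
      QuotientGroup.out_eq'] at hq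
    subst hq
    simpa using h
  · exact ⟨⟨g, ⟨_, QuotientGroup.eq.1 (QuotientGroup.out_eq' (g : G ⧸ K))⟩⟩, by simp⟩

theorem exists_pow_eq_pow_of_conj [K.Normal] (hK : K ≤ Subgroup.center G) {g h : G} {r : ℕ}
    (hr : r.Prime) (hg : orderOf (g : G ⧸ K) = r)
    (hh : (h * g * h⁻¹ : G ⧸ K) ∈ Subgroup.zpowers (g : G ⧸ K))
    (hne : (h * g * h⁻¹ : G ⧸ K) ≠ g) : ∃ z : K, g ^ r = (z : G) ^ r := by
  have hc : ∀ (x : K) (y : G), Commute y x := fun x y =>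
    (Subgroup.mem_center_iff.1 (hK x.2) y)
  obtain ⟨j, hj⟩ := hh
  have hw : g ^ r ∈ K := by
    rw [← QuotientGroup.eq_one_iff, QuotientGroup.mk_pow, ← hg, pow_orderOf_eq_one]
  have hcK : (g ^ j)⁻¹ * (h * g * h⁻¹) ∈ K := by
    rw [← QuotientGroup.eq]
    simpa using hj
  set c : K := ⟨_, hcK⟩ with hcdef
  set w : K := ⟨_, hw⟩ with hwdef
  have h1 : h * g * h⁻¹ = g ^ j * c := by simp [hcdef]
  have h2 : (h * g * h⁻¹) ^ r = g ^ r := by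
    rw [conj_pow]
    exact mul_inv_eq_iff_eq_mul.2 (hc w h)
  rw [h1, (hc c _).mul_pow, ← zpow_natCast (g ^ j), zpow_comm, zpow_natCast] at h2
  have h3 : (w : G) ^ j * (c : G) ^ r = w := h2
  have hjr : IsCoprime (j - 1) (r : ℤ) := by
    rw [isCoprime_comm, Int.isCoprime_iff_gcd_eq_one, Int.gcd_eq_natAbs_gcd_natAbs,
      Int.natAbs_natCast]
    refine (Nat.Prime.coprime_iff_not_dvd hr).2 fun hd => hne ?_
    have : (r : ℤ) ∣ j - 1 := Int.natCast_dvd.2 hd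
    rw [← hg, orderOf_dvd_iff_zpow_eq_one, zpow_sub_one] at this
    rw [← hj]
    exact mul_inv_eq_one.1 this
  obtain ⟨a, b, hab⟩ := hjr
  have hcr : (c : G) ^ (r : ℤ) = (w : G) ^ (1 - j) := by
    calc (c : G) ^ (r : ℤ) = (w ^ j : G)⁻¹ * (w ^ j * (c : G) ^ r) := by
          rw [inv_mul_cancel_left, zpow_natCast]
      _ = w ^ (1 - j) := by rw [h3, sub_eq_neg_add, zpow_add, zpow_neg, zpow_one]
  refine ⟨c ^ (-a) * w ^ b, ?_⟩
  have hcw : Commute ((c : G) ^ (-a)) ((w : G) ^ b) := ((hc w c).zpow_left _).zpow_right _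
  rw [Subgroup.coe_mul, Subgroup.coe_zpow, Subgroup.coe_zpow, hcw.mul_pow,
    ← zpow_natCast (_ ^ (-a)), ← zpow_natCast (_ ^ b), ← zpow_mul, ← zpow_mul, mul_comm (-a), zpow_mul,
    hcr, ← zpow_mul, ← zpow_add, show (1 - j) * -a + b * r = 1 by linarith, zpow_one]

theorem exists_pow_two_eq_of_odd_card (hK : Odd (Nat.card K)) {g : G} (hg : g ^ 2 ∈ K) :
    ∃ z : K, g ^ 2 = (z : G) ^ 2 := by
  obtain ⟨m, hm⟩ := hK
  refine ⟨⟨g ^ 2, hg⟩ ^ (m + 1), ?_⟩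
  have h := congrArg Subtype.val (pow_card_eq_one' (x := (⟨g ^ 2, hg⟩ : K)))
  rw [hm, Subgroup.coe_pow, Subgroup.coe_one] at h
  rw [Subgroup.coe_pow, ← pow_mul, show (m + 1) * 2 = 2 * m + 1 + 1 by ring,
    pow_succ ((⟨g ^ 2, hg⟩ : K) : G), h, one_mul]

theorem totient_mul_card_pow_le_psi [Fintype G] [hG : IsCyclic G] (k : ℕ) :
    (Nat.card G).totient * Nat.card G ^ k ≤ psi G k := by
  classical
  rw [psi, Nat.card_eq_fintype_card, ← IsCyclic.card_orderOf_eq_totient dvd_rfl,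
    ← smul_eq_mul, ← Finset.sum_const]
  refine le_trans (Finset.sum_le_sum fun x hx => ?_) (Finset.sum_le_univ_sum_of_nonneg (by simp))
  rw [(Finset.mem_filter.1 hx).2]

theorem sum_orderOf_mul_pow_le_of_card_le_totient [Fintype K] [IsCyclic K] {c : ℕ}
    (hc : Nat.card K ≤ c * (Nat.card K).totient) {g : G} {r : ℕ} (hr : r ≠ 0) (hg : g ^ r ∈ K)
    [K.Normal] (k : ℕ) : ∑ u : K, orderOf (g * u) ^ k ≤ c * r ^ k * psi K k := by
  have h : ∀ u : K, orderOf (g * u) ^ k ≤ (r * Nat.card K) ^ k := by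
    intro u
    refine Nat.pow_le_pow_left (Nat.le_of_dvd
      (Nat.mul_pos (Nat.pos_of_ne_zero hr) Nat.card_pos) (orderOf_dvd_of_pow_eq_one ?_)) k
    have hu : (g * u) ^ r ∈ K := by
      rw [← QuotientGroup.eq_one_iff, QuotientGroup.mk_pow, QuotientGroup.mk_mul_of_mem _ u.2,
        ← QuotientGroup.mk_pow, QuotientGroup.eq_one_iff]
      exact hg
    rw [pow_mul]
    exact congrArg Subtype.val (pow_card_eq_one' (x := (⟨_, hu⟩ : K)))
  refine (Finset.sum_le_sum fun u _ => h u).trans ?_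
  rw [Finset.sum_const, Finset.card_univ, ← Nat.card_eq_fintype_card, smul_eq_mul]
  calc Nat.card K * (r * Nat.card K) ^ k
      ≤ c * (Nat.card K).totient * (r * Nat.card K) ^ k := Nat.mul_le_mul_right _ hc
    _ = c * r ^ k * ((Nat.card K).totient * Nat.card K ^ k) := by ring
    _ ≤ _ := Nat.mul_le_mul_left _ (totient_mul_card_pow_le_psi k)

theorem psi_le_of_quotient [Fintype G] [Fintype K] [K.Normal] [IsCyclic K]
    [Nontrivial (G ⧸ K)] (hGK : TrivialSolvableRadical (G ⧸ K)) (h60 : Nat.card (G ⧸ K) = 60)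
    {k c : ℕ} (hck : c * 2 ^ k ≤ 3 ^ k)
    (h2 : ∀ g : G, orderOf (g : G ⧸ K) = 2 →
      ∑ u : K, orderOf (g * u) ^ k ≤ c * 2 ^ k * psi K k) :
    psi G k ≤ (1 + 15 * (c * 2 ^ k) + 20 * 3 ^ k + 24 * 5 ^ k) * psi K k := by
  classical
  have hK := le_center_of_commutator_quotient_eq_top (hGK.commutator_eq_top h60)
  have := Fintype.ofFinite (G ⧸ K)
  let w : ℕ → ℕ := fun d => if d = 2 then c * 2 ^ k else d ^ k
  have hw := hGK.sum_orderOf_le h60 w hck (Nat.pow_le_pow_left (by norm_num) k)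
  simp only [w, if_true, one_pow, OfNat.one_ne_ofNat, if_false] at hw
  norm_num at hw
  refine le_trans ?_ (Nat.mul_le_mul_right _ hw)
  rw [psi, sum_eq_sum_quotient_sum (K := K), Finset.sum_mul]
  refine Finset.sum_le_sum fun q _ => ?_
  have hq : (q.out : G ⧸ K) = q := QuotientGroup.out_eq' q
  generalize q.out = g at hq
  subst hq
  have hprime : ∀ r, r = 3 ∨ r = 5 → orderOf (g : G ⧸ K) = r →
      ∑ u : K, orderOf (g * u) ^ k ≤ r ^ k * psi K k := by
    intro r hr hg
    have hrp : r.Prime := by rcases hr with rfl | rfl <;> norm_num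
    obtain ⟨h, hh, hne⟩ := hGK.exists_conj_mem_zpowers_ne h60 hr hg
    obtain ⟨h, rfl⟩ := QuotientGroup.mk_surjective h
    obtain ⟨z, hz⟩ := exists_pow_eq_pow_of_conj hK hrp hg hh hne
    exact sum_orderOf_mul_pow_le hK hrp.ne_zero hz k
  rcases hGK.orderOf_mem h60 g with h | h | h | h
  · rw [orderOf_eq_one_iff, QuotientGroup.eq_one_iff] at h
    have := sum_orderOf_mul_pow_le (z := ⟨g, h⟩) hK one_ne_zero rfl k
    simpa [(QuotientGroup.eq_one_iff g).2 h] using this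
  · simpa [h] using h2 g h
  · simpa [h] using hprime 3 (Or.inl rfl) h
  · simpa [h] using hprime 5 (Or.inr rfl) h

theorem psi_le_of_quotient_of_odd_card [Fintype G] [Fintype K] [K.Normal] [IsCyclic K]
    [Nontrivial (G ⧸ K)] (hGK : TrivialSolvableRadical (G ⧸ K)) (h60 : Nat.card (G ⧸ K) = 60)
    (hs : Odd (Nat.card K)) (k : ℕ) :
    psi G k ≤ (1 + 15 * 2 ^ k + 20 * 3 ^ k + 24 * 5 ^ k) * psi K k := by
  have hK := le_center_of_commutator_quotient_eq_top (hGK.commutator_eq_top h60)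
  simpa using psi_le_of_quotient hGK h60 (c := 1)
    (by simpa using Nat.pow_le_pow_left (by norm_num) k) fun g hg => by
      have hg2 : g ^ 2 ∈ K := by
        rw [← QuotientGroup.eq_one_iff, QuotientGroup.mk_pow, ← hg, pow_orderOf_eq_one]
      obtain ⟨z, hz⟩ := exists_pow_two_eq_of_odd_card hs hg2
      simpa using sum_orderOf_mul_pow_le hK two_ne_zero hz k

theorem psi_le_of_quotient_of_card_le_totient [Fintype G] [Fintype K] [K.Normal] [IsCyclic K]
    [Nontrivial (G ⧸ K)] (hGK : TrivialSolvableRadical (G ⧸ K)) (h60 : Nat.card (G ⧸ K) = 60)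
    {k c : ℕ} (hck : c * 2 ^ k ≤ 3 ^ k) (hc : Nat.card K ≤ c * (Nat.card K).totient) :
    psi G k ≤ (1 + 15 * (c * 2 ^ k) + 20 * 3 ^ k + 24 * 5 ^ k) * psi K k :=
  psi_le_of_quotient hGK h60 hck fun g hg => by
    refine sum_orderOf_mul_pow_le_of_card_le_totient hc two_ne_zero ?_ k
    rw [← QuotientGroup.eq_one_iff, QuotientGroup.mk_pow, ← hg, pow_orderOf_eq_one]

end CentralExtension

/-- The sum of the `k`-th powers of the orders of the elements of a cyclic group of order `n`. -/
def cyclicPsi (k n : ℕ) : ℕ := ∑ d ∈ n.divisors, d.totient * d ^ k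

theorem psi_eq_cyclicPsi {G : Type*} [Group G] [Fintype G] [IsCyclic G] (k : ℕ) :
    psi G k = cyclicPsi k (Nat.card G) := by
  classical
  have hmaps : ∀ x ∈ (Finset.univ : Finset G), orderOf x ∈ (Nat.card G).divisors := fun x _ =>
    Nat.mem_divisors.2 ⟨orderOf_dvd_natCard x, Nat.card_pos.ne'⟩
  rw [psi, cyclicPsi, ← Finset.sum_fiberwise_of_maps_to hmaps]
  refine Finset.sum_congr rfl fun d hd => ?_
  rw [Finset.sum_congr rfl fun x hx => by rw [(Finset.mem_filter.1 hx).2], Finset.sum_const,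
    smul_eq_mul, IsCyclic.card_orderOf_eq_totient]
  rw [← Nat.card_eq_fintype_card]
  exact Nat.dvd_of_mem_divisors hd

theorem cyclicPsi_mul_of_coprime {a b : ℕ} (h : a.Coprime b) (k : ℕ) :
    cyclicPsi k (a * b) = cyclicPsi k a * cyclicPsi k b := by
  rw [cyclicPsi, Nat.divisors_mul, Finset.mul_def, Finset.sum_image h.mul_injOn_divisors,
    cyclicPsi, cyclicPsi, Finset.sum_mul_sum, ← Finset.sum_product']
  refine Finset.sum_congr rfl fun x hx => ?_
  obtain ⟨h1, h2⟩ := Finset.mem_product.1 hx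
  rw [Nat.totient_mul ((h.coprime_dvd_left (Nat.dvd_of_mem_divisors h1)).coprime_dvd_right
    (Nat.dvd_of_mem_divisors h2)), mul_pow, mul_mul_mul_comm]

theorem cyclicPsi_prime_pow_succ {p : ℕ} (hp : p.Prime) (k i : ℕ) :
    cyclicPsi k (p ^ (i + 1)) = cyclicPsi k (p ^ i) + (p ^ i * (p - 1)) * (p ^ (i + 1)) ^ k := by
  rw [cyclicPsi, cyclicPsi, Nat.sum_divisors_prime_pow hp, Nat.sum_divisors_prime_pow hp,
    Finset.sum_range_succ, Nat.totient_prime_pow_succ hp]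

theorem cyclicPsi_one (k : ℕ) : cyclicPsi k 1 = 1 := by simp [cyclicPsi]

theorem cyclicPsi_prime {p : ℕ} (hp : p.Prime) (k : ℕ) :
    cyclicPsi k p = 1 + (p - 1) * p ^ k := by
  simpa [cyclicPsi_one] using cyclicPsi_prime_pow_succ hp k 0

theorem cyclicPsi_four (k : ℕ) : cyclicPsi k 4 = 1 + 2 ^ k + 2 * 4 ^ k := by
  simpa [cyclicPsi_prime Nat.prime_two] using cyclicPsi_prime_pow_succ Nat.prime_two k 1

theorem totient_mul_pow_le_cyclicPsi {n : ℕ} (hn : n ≠ 0) (k : ℕ) :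
    n.totient * n ^ k ≤ cyclicPsi k n :=
  Finset.single_le_sum (f := fun d => d.totient * d ^ k) (by simp) (Nat.mem_divisors_self n hn)

theorem cyclicPsi_le (k n : ℕ) : cyclicPsi k n ≤ n * n ^ k := by
  nth_rw 2 [← Nat.sum_totient n]
  rw [cyclicPsi, Finset.sum_mul]
  exact Finset.sum_le_sum fun d hd => Nat.mul_le_mul_left _
    (Nat.pow_le_pow_left (Nat.divisor_le hd) k)

theorem cyclicPsi_prime_mul_le {p s : ℕ} (hp : p.Prime) (hs : s ≠ 0) (k : ℕ) :
    cyclicPsi k p * cyclicPsi k s ≤ cyclicPsi k (p * s) := by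
  obtain ⟨i, t, ht, rfl⟩ := Nat.exists_eq_pow_mul_and_not_dvd hs p hp.ne_one
  have hc : ∀ j, (p ^ j).Coprime t := fun j =>
    Nat.Coprime.pow_left _ ((Nat.Prime.coprime_iff_not_dvd hp).2 ht)
  rw [← mul_assoc, ← pow_succ', cyclicPsi_mul_of_coprime (hc _), cyclicPsi_mul_of_coprime (hc _),
    ← mul_assoc]
  refine Nat.mul_le_mul_right _ ?_
  rw [cyclicPsi_prime hp, cyclicPsi_prime_pow_succ hp, add_mul, one_mul]
  refine Nat.add_le_add_left ((Nat.mul_le_mul_left _ (cyclicPsi_le k _)).trans_eq ?_) _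
  rw [pow_succ, mul_pow]
  ring

theorem cyclicPsi_four_mul_of_odd {s : ℕ} (hs : Odd s) (k : ℕ) :
    cyclicPsi k (4 * s) = cyclicPsi k 4 * cyclicPsi k s :=
  cyclicPsi_mul_of_coprime (Nat.Coprime.pow_left 2 (Nat.coprime_two_left.2 hs)) k

theorem cyclicPsi_four_mul_of_even {s k : ℕ} (hk : 13 ≤ k) (hs₀ : s ≠ 0) (hs : Even s) :
    3 * (cyclicPsi k 4 * cyclicPsi k s) ≤ 2 * cyclicPsi k (4 * s) := by
  obtain ⟨i, t, ht, rfl⟩ := Nat.exists_eq_pow_mul_and_not_dvd hs₀ 2 (by norm_num)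
  have hc : ∀ j, (2 ^ j).Coprime t := fun j =>
    Nat.Coprime.pow_left _ ((Nat.Prime.coprime_iff_not_dvd Nat.prime_two).2 ht)
  rcases i with _ | i
  · rw [pow_zero, one_mul, even_iff_two_dvd] at hs
    exact absurd hs ht
  rw [← mul_assoc 4, show 4 * 2 ^ (i + 1) = 2 ^ (i + 2 + 1) by ring,
    cyclicPsi_mul_of_coprime (hc _), cyclicPsi_mul_of_coprime (hc _), ← mul_assoc, ← mul_assoc,
    ← mul_assoc]
  refine Nat.mul_le_mul_right _ ?_
  rw [cyclicPsi_four, cyclicPsi_prime_pow_succ Nat.prime_two k (i + 2),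
    cyclicPsi_prime_pow_succ Nat.prime_two k i]
  have h1 := cyclicPsi_le k (2 ^ i)
  have hX : 2 ^ 13 ≤ 2 ^ k := Nat.pow_le_pow_right (by norm_num) hk
  have e4 : 4 ^ k = 2 ^ k * 2 ^ k := by rw [← mul_pow]; rfl
  have e1 : (2 ^ (i + 1)) ^ k = (2 ^ i) ^ k * 2 ^ k := by rw [pow_succ, mul_pow]
  have e3 : (2 ^ (i + 2 + 1)) ^ k = (2 ^ i) ^ k * (2 ^ k * 2 ^ k * 2 ^ k) := by
    rw [← mul_pow, ← mul_pow, ← mul_pow]; ring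
  rw [e4, e1, e3]
  generalize 2 ^ k = X at *
  have e5 : cyclicPsi k (2 ^ i) + 2 ^ i * (2 - 1) * ((2 ^ i) ^ k * X) ≤
      2 ^ i * (2 ^ i) ^ k * (1 + X) := by
    nlinarith
  have e6 : 3 * (1 + X + 2 * (X * X)) * (1 + X) ≤ 8 * (X * X * X) := by
    obtain ⟨Y, rfl⟩ := Nat.exists_eq_add_of_le hX
    ring_nf
    nlinarith
  calc _ ≤ 3 * (1 + X + 2 * (X * X)) * (2 ^ i * (2 ^ i) ^ k * (1 + X)) :=
        Nat.mul_le_mul_left _ e5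
    _ = 3 * (1 + X + 2 * (X * X)) * (1 + X) * (2 ^ i * (2 ^ i) ^ k) := by ring
    _ ≤ 8 * (X * X * X) * (2 ^ i * (2 ^ i) ^ k) := Nat.mul_le_mul_right _ e6
    _ = 2 * (2 ^ (i + 2) * (2 - 1) * ((2 ^ i) ^ k * (X * X * X))) := by ring
    _ ≤ _ := Nat.mul_le_mul_left _ (Nat.le_add_left _ _)

theorem mul_prod_le_totient {n : ℕ} {T : Finset ℕ} (hT : n.primeFactors ⊆ T)
    (h1 : ∀ j ∈ T, 1 ≤ j) : (n : ℚ) * ∏ j ∈ T, (1 - (j : ℚ)⁻¹) ≤ n.totient := by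
  have h0 : ∀ j ∈ T, 0 ≤ 1 - (j : ℚ)⁻¹ := fun j hj =>
    sub_nonneg.2 (inv_le_one_of_one_le₀ (by exact_mod_cast h1 j hj))
  rw [Nat.totient_eq_mul_prod_factors, ← Finset.prod_sdiff hT]
  refine mul_le_mul_of_nonneg_left (mul_le_of_le_one_left
    (Finset.prod_nonneg fun j hj => h0 j (hT hj)) (Finset.prod_le_one
    (fun j hj => h0 j (Finset.sdiff_subset hj)) fun j _ => ?_)) (by positivity)
  simp

theorem prod_Icc_two_one_sub_inv (P : ℕ) :
    ∏ j ∈ Finset.Icc 2 (P + 1), (1 - (j : ℚ)⁻¹) = ((P + 1 : ℕ) : ℚ)⁻¹ := by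
  induction P with
  | zero => simp
  | succ P ih =>
    rw [Finset.prod_Icc_succ_top (by omega), ih]
    push_cast
    field_simp
    ring

theorem le_mul_totient {n P : ℕ} (hP : P ≠ 0) (h : ∀ p ∈ n.primeFactors, p ≤ P) :
    n ≤ P * n.totient := by
  obtain ⟨P, rfl⟩ := Nat.exists_eq_succ_of_ne_zero hP
  have := mul_prod_le_totient (n := n) (T := Finset.Icc 2 (P + 1)) (fun p hp =>
    Finset.mem_Icc.2 ⟨(Nat.prime_of_mem_primeFactors hp).two_le, h p hp⟩)
    (fun j hj => by have := Finset.mem_Icc.1 hj; omega)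
  rw [prod_Icc_two_one_sub_inv, mul_inv_le_iff₀ (by positivity), mul_comm] at this
  exact_mod_cast this

theorem le_six_mul_totient {n : ℕ} (h : ∀ p ∈ n.primeFactors, p ≤ 13) : n ≤ 6 * n.totient := by
  have := mul_prod_le_totient (n := n) (T := {2, 3, 5, 7, 11, 13}) (fun p hp => by
    have h1 := Nat.prime_of_mem_primeFactors hp
    have h2 := h p hp
    clear hp
    interval_cases p <;> first | decide | (exfalso; revert h1; norm_num)) (by decide)
  norm_num at this
  have h0 : (0 : ℚ) ≤ n := by positivity
  have : (n : ℚ) ≤ 6 * n.totient := by linarith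
  exact_mod_cast this

/-- The numerator `ψ_k(A₅)` of the critical ratio. -/
def criticalNum (k : ℕ) : ℕ := 1 + 15 * 2 ^ k + 20 * 3 ^ k + 24 * 5 ^ k

/-- The denominator `ψ_k(ℤ₆₀)` of the critical ratio. -/
def criticalDen (k : ℕ) : ℕ := (1 + 2 ^ k + 2 * 4 ^ k) * (1 + 2 * 3 ^ k) * (1 + 4 * 5 ^ k)

theorem criticalDen_le {k : ℕ} (hk : 13 ≤ k) :
    10 * criticalDen k ≤ 9 * 12 ^ k * criticalNum k := by
  have h2 : 2 ^ 13 ≤ 2 ^ k := Nat.pow_le_pow_right (by norm_num) hk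
  have h3 : 3 ^ 13 ≤ 3 ^ k := Nat.pow_le_pow_right (by norm_num) hk
  have h5 : 5 ^ 13 ≤ 5 ^ k := Nat.pow_le_pow_right (by norm_num) hk
  have e4 : 4 ^ k = 2 ^ k * 2 ^ k := by rw [← mul_pow]; rfl
  have e12 : 12 ^ k = 2 ^ k * 2 ^ k * 3 ^ k := by rw [← mul_pow, ← mul_pow]; rfl
  rw [criticalDen, criticalNum, e4, e12]
  generalize 2 ^ k = A at *
  generalize 3 ^ k = B at *
  generalize 5 ^ k = E at *
  have hA : 4 * (1 + A + 2 * (A * A)) ≤ 9 * (A * A) := by nlinarith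
  have hB : 4 * (1 + 2 * B) ≤ 9 * B := by omega
  have hE : 4 * (1 + 4 * E) ≤ 17 * E := by omega
  have := Nat.mul_le_mul (Nat.mul_le_mul hA hB) hE
  have h1 : 9 * (A * A * B) * (24 * E) ≤
      9 * (A * A * B) * (1 + 15 * A + 20 * B + 24 * E) := Nat.mul_le_mul_left _ (by omega)
  nlinarith

theorem criticalDen_eq (k : ℕ) :
    criticalDen k = cyclicPsi k 4 * cyclicPsi k 3 * cyclicPsi k 5 := by
  rw [criticalDen, cyclicPsi_four, cyclicPsi_prime Nat.prime_three, cyclicPsi_prime Nat.prime_five]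

theorem cyclicPsi_four_mul_mul_le {s : ℕ} (hs : s ≠ 0) (k : ℕ) :
    cyclicPsi k (4 * s) * (cyclicPsi k 3 * cyclicPsi k 5) ≤ cyclicPsi k (60 * s) := by
  have h3 := cyclicPsi_prime_mul_le Nat.prime_three (s := 4 * s) (by omega) k
  have h5 := cyclicPsi_prime_mul_le Nat.prime_five (s := 3 * (4 * s)) (by omega) k
  rw [show 5 * (3 * (4 * s)) = 60 * s by ring] at h5
  calc _ = cyclicPsi k 5 * (cyclicPsi k 3 * cyclicPsi k (4 * s)) := by ring
    _ ≤ _ := (Nat.mul_le_mul_left _ h3).trans h5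

theorem criticalDen_mul_le_of_odd {s : ℕ} (hs : Odd s) (k : ℕ) :
    criticalDen k * cyclicPsi k s ≤ cyclicPsi k (60 * s) := by
  refine le_trans (le_of_eq ?_) (cyclicPsi_four_mul_mul_le hs.pos.ne' k)
  rw [criticalDen_eq, cyclicPsi_four_mul_of_odd hs]
  ring

theorem criticalDen_mul_le_of_even {s k : ℕ} (hk : 13 ≤ k) (hs₀ : s ≠ 0) (hs : Even s) :
    3 * (criticalDen k * cyclicPsi k s) ≤ 2 * cyclicPsi k (60 * s) := by
  have h1 := cyclicPsi_four_mul_mul_le hs₀ k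
  have h2 := Nat.mul_le_mul_right (cyclicPsi k 3 * cyclicPsi k 5)
    (cyclicPsi_four_mul_of_even hk hs₀ hs)
  rw [criticalDen_eq]
  linarith

theorem two_mul_le_three_mul_criticalNum {k : ℕ} (hk : 13 ≤ k) :
    2 * (1 + 15 * (6 * 2 ^ k) + 20 * 3 ^ k + 24 * 5 ^ k) ≤ 3 * criticalNum k := by
  have h : 6 * 2 ^ k ≤ 5 ^ k := by
    obtain ⟨j, rfl⟩ := Nat.exists_eq_add_of_le hk
    have := Nat.pow_le_pow_left (show 2 ≤ 5 by norm_num) j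
    rw [pow_add, pow_add]
    omega
  rw [criticalNum]
  omega

theorem exists_index_pow_lt {G : Type*} [Group G] [Fintype G] {k : ℕ} (hk : 13 ≤ k)
    (h : criticalNum k * cyclicPsi k (Nat.card G) < criticalDen k * psi G k) :
    ∃ x : G, 10 * (Nat.card G).totient * (Subgroup.zpowers x).index ^ k <
      9 * 12 ^ k * Nat.card G := by
  obtain ⟨x, hx⟩ := Finite.exists_max (fun x : G => orderOf x)
  refine ⟨x, ?_⟩
  have hpsi : psi G k ≤ Nat.card G * orderOf x ^ k := by
    rw [psi, Nat.card_eq_fintype_card, ← Finset.card_univ, ← smul_eq_mul, ← Finset.sum_const]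
    exact Finset.sum_le_sum fun y _ => Nat.pow_le_pow_left (hx y) k
  have hi := (Subgroup.zpowers x).card_mul_index
  rw [Nat.card_zpowers] at hi
  have hf := totient_mul_pow_le_cyclicPsi (n := Nat.card G) Nat.card_pos.ne' k
  have hD := criticalDen_le hk
  have hN : 0 < criticalNum k := by rw [criticalNum]; positivity
  have hox : 0 < orderOf x ^ k := pow_pos (orderOf_pos x) k
  have h1 : criticalNum k * ((Nat.card G).totient * Nat.card G ^ k) <
      criticalDen k * (Nat.card G * orderOf x ^ k) :=
    (Nat.mul_le_mul_left _ hf).trans_lt (h.trans_le (Nat.mul_le_mul_left _ hpsi))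
  have h2 : Nat.card G ^ k = orderOf x ^ k * (Subgroup.zpowers x).index ^ k := by
    rw [← mul_pow, hi]
  rw [h2] at h1
  generalize (Subgroup.zpowers x).index ^ k = I at *
  generalize (Nat.card G).totient = t at *
  generalize orderOf x ^ k = o at *
  have h3 : criticalNum k * (t * I) < criticalDen k * Nat.card G := by
    refine lt_of_mul_lt_mul_right (a := o) ?_ (Nat.zero_le _)
    linarith
  refine lt_of_mul_lt_mul_right (a := criticalNum k) ?_ (Nat.zero_le _)
  have h4 := Nat.mul_le_mul_right (Nat.card G) hD
  linarith

theorem index_le_thirteen {t n i k : ℕ} (hk : 13 ≤ k) (ht : n ≤ 6 * t)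
    (h : 10 * t * i ^ k < 9 * 12 ^ k * n) : i ≤ 13 := by
  by_contra! hi
  obtain ⟨j, rfl⟩ := Nat.exists_eq_add_of_le hk
  have h1 : 14 ^ (13 + j) ≤ i ^ (13 + j) := Nat.pow_le_pow_left hi _
  have h2 : 12 ^ j ≤ 14 ^ j := Nat.pow_le_pow_left (by norm_num) _
  have h3 : 54 * 12 ^ (13 + j) ≤ 10 * 14 ^ (13 + j) := by
    rw [pow_add, pow_add]
    omega
  have h4 := Nat.mul_le_mul_left (10 * t) h1
  have h5 := Nat.mul_le_mul_left (9 * 12 ^ (13 + j)) ht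
  have h6 := Nat.mul_le_mul_left t h3
  linarith

theorem index_lt_prime {t n i k p : ℕ} (hk : 13 ≤ k) (hp : 17 ≤ p) (ht : n ≤ p * t)
    (h : 10 * t * i ^ k < 9 * 12 ^ k * n) : i < p := by
  by_contra! hi
  obtain ⟨j, rfl⟩ := Nat.exists_eq_add_of_le hk
  have h1 : p ^ (13 + j) ≤ i ^ (13 + j) := Nat.pow_le_pow_left hi _
  have h3 : 9 * 12 ^ (13 + j) ≤ 10 * p ^ (12 + j) := by
    have h2 : 12 ^ j ≤ p ^ j := Nat.pow_le_pow_left (by omega) _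
    have h4 : 9 * 12 ^ 13 ≤ 10 * p ^ 12 :=
      le_trans (by norm_num) (Nat.mul_le_mul_left 10 (Nat.pow_le_pow_left hp 12))
    rw [pow_add, pow_add, ← mul_assoc, ← mul_assoc]
    exact Nat.mul_le_mul h4 h2
  have h4 := Nat.mul_le_mul_left (10 * t) h1
  have h5 := Nat.mul_le_mul_left (9 * 12 ^ (13 + j)) ht
  have h6 := Nat.mul_le_mul_left (p * t) h3
  have h7 : p ^ (13 + j) = p * p ^ (12 + j) := by rw [← pow_succ']; congr 1; omega
  rw [h7] at h4
  linarith

section NormalSylow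

variable {G : Type*} [Group G]

theorem exists_normal_sylow [Finite G] {A : Subgroup G} [IsCyclic A] {p : ℕ} [hp : Fact p.Prime]
    (hA : A.index < p) : ∃ P : Sylow p G, (P : Subgroup G).Normal ∧ IsCyclic P := by
  let P : Sylow p A := default
  have hQ : IsPGroup p ((P : Subgroup A).map A.subtype) := P.isPGroup'.map _
  have hi : ¬ p ∣ ((P : Subgroup A).map A.subtype).index := by
    rw [Subgroup.index_map_subtype, hp.out.dvd_mul, not_or]
    exact ⟨P.not_dvd_index, Nat.not_dvd_of_pos_of_lt
      (Nat.pos_of_ne_zero Subgroup.index_ne_zero_of_finite) hA⟩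
  have hle : (P : Subgroup A).map A.subtype ≤ A := Subgroup.map_subtype_le _
  have hcyc : IsCyclic ((P : Subgroup A).map A.subtype) :=
    isCyclic_of_injective (Subgroup.inclusion hle) (Subgroup.inclusion_injective hle)
  refine ⟨hQ.toSylow hi, ?_, hcyc⟩
  have hcomm : ∀ a ∈ A, ∀ b ∈ A, a * b = b * a := fun a ha b hb =>
    congrArg Subtype.val ((IsCyclic.isMulCommutative (α := A)).is_comm.comm ⟨a, ha⟩ ⟨b, hb⟩)
  have hn : A ≤ Subgroup.normalizer ((hQ.toSylow hi : Subgroup G) : Set G) := by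
    intro a ha
    rw [Subgroup.mem_normalizer_iff]
    intro b
    constructor
    · intro hb
      have : a * b * a⁻¹ = b := by rw [hcomm a ha b (hle hb), mul_inv_cancel_right]
      rwa [this]
    · intro hb
      have : a * b * a⁻¹ = b := mul_left_cancel
        ((hcomm a ha _ (hle hb)).trans (inv_mul_cancel_right (a * b) a))
      rwa [this] at hb
  have hcard : Nat.card (Sylow p G) < p := by
    rw [Sylow.card_eq_index_normalizer (hQ.toSylow hi)]
    exact (Nat.le_of_dvd (Nat.pos_of_ne_zero Subgroup.index_ne_zero_of_finite)
      (Subgroup.index_dvd_of_le hn)).trans_lt hA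
  have hone : Nat.card (Sylow p G) = 1 := by
    have := card_sylow_modEq_one p G
    rwa [Nat.ModEq, Nat.mod_eq_of_lt hcard, Nat.mod_eq_of_lt hp.out.one_lt] at this
  rw [Sylow.card_eq_index_normalizer (hQ.toSylow hi), Subgroup.index_eq_one] at hone
  exact Subgroup.normalizer_eq_top_iff.1 hone

theorem zpowers_normal_of_mem [Finite G] {Q : Subgroup G} [hQ : Q.Normal] [IsCyclic Q] {u : G}
    (hu : u ∈ Q) : (Subgroup.zpowers u).Normal := by
  refine ⟨fun y hy g => ?_⟩
  obtain ⟨j, rfl⟩ := Subgroup.mem_zpowers_iff.1 hy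
  rw [← conj_zpow]
  refine Subgroup.zpow_mem _ (mem_zpowers_of_orderOf_eq hu (hQ.conj_mem u hu g) ?_) j
  exact orderOf_injective (MulAut.conj g).toMonoidHom (MulAut.conj g).injective u

theorem orderOf_mul_dvd [Finite G] {Q : Subgroup G} [Q.Normal] [IsCyclic Q] {u : G}
    (hu : u ∈ Q) (h : G) : orderOf (u * h) ∣ orderOf u * orderOf h := by
  have := zpowers_normal_of_mem hu
  have h1 : (u * h) ^ orderOf h ∈ Subgroup.zpowers u := by
    rw [← QuotientGroup.eq_one_iff, QuotientGroup.mk_pow, QuotientGroup.mk_mul,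
      (QuotientGroup.eq_one_iff u).2 (Subgroup.mem_zpowers u), one_mul, ← QuotientGroup.mk_pow,
      pow_orderOf_eq_one, QuotientGroup.mk_one]
  rw [orderOf_dvd_iff_pow_eq_one, mul_comm, pow_mul]
  exact orderOf_dvd_iff_pow_eq_one.1 (orderOf_dvd_of_mem_zpowers h1)

theorem psi_le_of_isComplement' [Fintype G] {Q H : Subgroup G} [Fintype Q] [Fintype H] [Q.Normal]
    [IsCyclic Q] (hQH : Q.IsComplement' H) (k : ℕ) : psi G k ≤ psi Q k * psi H k := by
  have e : psi G k = ∑ x : Q × H, orderOf ((x.1 : G) * x.2) ^ k :=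
    ((Equiv.ofBijective _ hQH).sum_comp fun g => orderOf g ^ k).symm
  rw [e, psi, psi, Finset.sum_mul_sum, ← Finset.sum_product']
  refine Finset.sum_le_sum fun x _ => ?_
  rw [← mul_pow, ← Subgroup.orderOf_coe, ← Subgroup.orderOf_coe]
  exact Nat.pow_le_pow_left (Nat.le_of_dvd (Nat.mul_pos (orderOf_pos _) (orderOf_pos _))
    (orderOf_mul_dvd x.1.2 _)) k

theorem exists_trivialSolvableRadical_quotient [Finite G] :
    ∃ (R : Subgroup G) (_ : R.Normal), Group.IsSolvable R ∧ TrivialSolvableRadical (G ⧸ R) := by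
  have hfin : {R : Subgroup G | R.Normal ∧ Group.IsSolvable R}.Finite := Set.toFinite _
  obtain ⟨R, -, hR⟩ := hfin.exists_le_maximal (a := ⊥) ⟨inferInstance, inferInstance⟩
  obtain ⟨hRn, hRs⟩ := hR.prop
  refine ⟨R, hRn, hRs, fun N hN hNs => ?_⟩
  have hle : R ≤ N.comap (QuotientGroup.mk' R) := fun x hx => by
    rw [Subgroup.mem_comap, QuotientGroup.mk'_apply, (QuotientGroup.eq_one_iff x).2 hx]
    exact N.one_mem
  have hs : Group.IsSolvable (N.comap (QuotientGroup.mk' R)) := by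
    refine Group.isSolvable_of_ker_le_range (Subgroup.inclusion hle)
      ((QuotientGroup.mk' R).subgroupComap N) fun x hx => ?_
    have hx' : (QuotientGroup.mk' R) (x : G) = 1 := congrArg Subtype.val hx
    exact ⟨⟨x, (QuotientGroup.eq_one_iff (x : G)).1 hx'⟩, rfl⟩
  have hge := hR.le_of_ge ⟨hN.comap _, hs⟩ hle
  rw [eq_bot_iff]
  intro y hy
  obtain ⟨x, rfl⟩ := QuotientGroup.mk'_surjective R y
  exact (QuotientGroup.eq_one_iff x).2 (hge hy)

end NormalSylow

theorem isSolvable_of_primeFactors_le_thirteen {G : Type*} [Group G] [Fintype G] {k : ℕ}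
    (hk : 13 ≤ k) (hp : ∀ p ∈ (Nat.card G).primeFactors, p ≤ 13)
    (h : criticalNum k * cyclicPsi k (Nat.card G) < criticalDen k * psi G k) :
    Group.IsSolvable G := by
  obtain ⟨x, hx⟩ := exists_index_pow_lt hk h
  have hi := index_le_thirteen hk (le_six_mul_totient hp) hx
  obtain ⟨R, hRn, hRs, hR⟩ := exists_trivialSolvableRadical_quotient (G := G)
  rcases subsingleton_or_nontrivial (G ⧸ R) with hsub | hnt
  · exact isSolvable_of_normal_of_quotient hRn hRs inferInstance
  exfalso
  let B : Subgroup (G ⧸ R) := (Subgroup.zpowers x).map (QuotientGroup.mk' R)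
  have hB : IsCyclic B := isCyclic_of_surjective _
    ((QuotientGroup.mk' R).subgroupMap_surjective (Subgroup.zpowers x))
  have hpos : 0 < (Subgroup.zpowers x).index :=
    Nat.pos_of_ne_zero Subgroup.index_ne_zero_of_finite
  have hdvd : B.index ∣ (Subgroup.zpowers x).index :=
    Subgroup.index_map_dvd _ (QuotientGroup.mk'_surjective R)
  obtain ⟨h60, hB5⟩ := hR.card_eq_of_index_le_thirteen (A := B)
    ((Nat.le_of_dvd hpos hdvd).trans hi)
  have hB12 : B.index = 12 := by
    have := B.card_mul_index
    rw [hB5, h60] at this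
    omega
  have hx12 : (Subgroup.zpowers x).index = 12 := by
    rw [hB12] at hdvd
    omega
  have hRx : R ≤ Subgroup.zpowers x := by
    have h1 : B.index = (Subgroup.zpowers x ⊔ R).index := by
      rw [Subgroup.index_map, QuotientGroup.ker_mk', QuotientGroup.range_mk', Subgroup.index_top,
        mul_one]
    refine sup_eq_left.1 ((Subgroup.eq_of_le_of_card_ge le_sup_left ?_).symm)
    have h2 := (Subgroup.zpowers x).card_mul_index
    have h3 := (Subgroup.zpowers x ⊔ R).card_mul_index
    rw [← h1, hB12] at h3
    rw [hx12] at h2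
    omega
  have hRc : IsCyclic R := isCyclic_of_injective (Subgroup.inclusion hRx)
    (Subgroup.inclusion_injective hRx)
  have : Fintype R := Fintype.ofFinite R
  have hn : Nat.card G = 60 * Nat.card R := by
    rw [Subgroup.card_eq_card_quotient_mul_card_subgroup R, h60]
  have hR0 : Nat.card R ≠ 0 := Nat.card_pos.ne'
  rw [hn] at h
  rcases Nat.even_or_odd (Nat.card R) with hev | hodd
  · have h6 : 6 * 2 ^ k ≤ 3 ^ k := by
      obtain ⟨j, rfl⟩ := Nat.exists_eq_add_of_le hk
      have := Nat.pow_le_pow_left (show 2 ≤ 3 by norm_num) j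
      rw [pow_add, pow_add]
      omega
    have h1 := psi_le_of_quotient_of_card_le_totient hR h60 h6 (le_six_mul_totient fun p hpR =>
      hp p (Nat.primeFactors_mono (Subgroup.card_subgroup_dvd_card R) Nat.card_pos.ne' hpR))
    rw [psi_eq_cyclicPsi (G := R)] at h1
    have h2 := two_mul_le_three_mul_criticalNum hk
    have h3 := criticalDen_mul_le_of_even hk hR0 hev
    have h4 := Nat.mul_le_mul_left (2 * criticalDen k) h1
    have h5 := Nat.mul_le_mul_right (criticalDen k * cyclicPsi k (Nat.card R)) h2
    have h7 := Nat.mul_le_mul_left (criticalNum k) h3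
    nlinarith
  · have h1 := psi_le_of_quotient_of_odd_card hR h60 hodd k
    rw [psi_eq_cyclicPsi (G := R)] at h1
    have h2 := Nat.mul_le_mul_left (criticalNum k) (criticalDen_mul_le_of_odd hodd k)
    have h3 := Nat.mul_le_mul_left (criticalDen k) h1
    rw [← criticalNum] at h3
    nlinarith

theorem isSolvable_of_criticalNum_mul_lt {k : ℕ} (hk : 13 ≤ k) (G : Type*) [Group G] [Fintype G]
    (h : criticalNum k * cyclicPsi k (Nat.card G) < criticalDen k * psi G k) :
    Group.IsSolvable G := by
  classical
  generalize hm : Nat.card G = m at h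
  induction m using Nat.strong_induction_on generalizing G with
  | _ m ih =>
  subst hm
  by_cases hp : ∀ p ∈ (Nat.card G).primeFactors, p ≤ 13
  · exact isSolvable_of_primeFactors_le_thirteen hk hp h
  push Not at hp
  obtain ⟨q, hq, hq13⟩ := hp
  obtain ⟨p, hpn, hmax⟩ := Finset.exists_max_image (Nat.card G).primeFactors id ⟨q, hq⟩
  have hpp := Nat.prime_of_mem_primeFactors hpn
  have h17 : 17 ≤ p := by
    have : q ≤ p := hmax q hq
    by_contra hlt
    have : p < 17 := by omega
    interval_cases p <;> first | omega | (revert hpp; norm_num)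
  have := Fact.mk hpp
  obtain ⟨x, hx⟩ := exists_index_pow_lt hk h
  obtain ⟨Q, hQn, hQc⟩ := exists_normal_sylow
    (index_lt_prime hk h17 (le_mul_totient hpp.ne_zero hmax) hx)
  have hcop : (Nat.card Q).Coprime (Q : Subgroup G).index := Q.card_coprime_index
  obtain ⟨H, hH⟩ := Subgroup.exists_right_complement'_of_coprime hcop
  have hcard : Nat.card Q * Nat.card H = Nat.card G := hH.card_mul_card
  have hQ1 : 1 < Nat.card Q := by
    refine Nat.lt_of_le_of_ne Nat.card_pos fun h1 => ?_
    have := Q.dvd_card_of_dvd_card (Nat.dvd_of_mem_primeFactors hpn)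
    rw [← h1] at this
    exact hpp.one_lt.ne' (Nat.dvd_one.1 this)
  have hHs : Group.IsSolvable H := by
    refine ih (Nat.card H) ?_ H rfl ?_
    · rw [← hcard]
      exact lt_mul_of_one_lt_left Nat.card_pos hQ1
    · have h1 := psi_le_of_isComplement' hH k
      rw [psi_eq_cyclicPsi (G := Q)] at h1
      have hcop' : (Nat.card Q).Coprime (Nat.card H) := by
        rwa [hH.symm.index_eq_card] at hcop
      rw [← hcard, cyclicPsi_mul_of_coprime hcop'] at h
      have h2 := Nat.mul_le_mul_left (criticalDen k) h1
      refine lt_of_mul_lt_mul_left (a := cyclicPsi k (Nat.card Q)) ?_ (Nat.zero_le _)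
      linarith
  refine isSolvable_of_normal_of_quotient hQn
    (Group.isSolvable_of_comm (IsCyclic.isMulCommutative (α := Q)).is_comm.comm) ?_
  refine Group.isSolvable_of_surjective
    (f := (QuotientGroup.mk' (Q : Subgroup G)).comp H.subtype) fun y => ?_
  obtain ⟨g, rfl⟩ := QuotientGroup.mk'_surjective _ y
  obtain ⟨⟨u, w⟩, rfl⟩ := hH.2 g
  refine ⟨w, ?_⟩
  have hu : QuotientGroup.mk' (Q : Subgroup G) (u : G) = 1 :=
    (QuotientGroup.eq_one_iff (u : G)).2 u.2
  exact ((map_mul _ _ _).trans (by rw [hu, one_mul]; rfl)).symm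

theorem solvable_of_psi_gt_of_prime_divisor_gt_five
    (G : Type*) [Group G] [Fintype G] (n : ℕ) [NeZero n] (hn : Fintype.card G = n)
    (h5 : ∃ p : ℕ, p.Prime ∧ p ∣ n ∧ 5 < p)
    (k : ℕ) (hk : 13 ≤ k)
    (h : (psi G k : ℚ) >
        ((1 + 15 * 2 ^ k + 20 * 3 ^ k + 24 * 5 ^ k : ℚ) /
          ((1 + 2 ^ k + 2 * 4 ^ k) * (1 + 2 * 3 ^ k) * (1 + 4 * 5 ^ k))) *
        (psi (Multiplicative (ZMod n)) k : ℚ)) :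
    IsSolvable G := by
  have hcard : Nat.card (Multiplicative (ZMod n)) = n := Nat.card_zmod n
  rw [psi_eq_cyclicPsi (G := Multiplicative (ZMod n)), hcard, gt_iff_lt, div_mul_eq_mul_div,
    div_lt_iff₀ (by positivity)] at h
  refine isSolvable_of_criticalNum_mul_lt hk G ?_
  rw [Nat.card_eq_fintype_card, hn, mul_comm (criticalDen k), criticalNum, criticalDen]
  exact_mod_cast h
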